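/- arXiv:2301.01708 — 5 statements merged into one kernel-verified Lean document; each statement's English description precedes it below -/
import Mathlib

section
/- Let n ≥ 4. For integers a with 0 ≤ a ≤ ⌊(n−4)/2⌋ set b = n − 4 − a. Then the 𝓔-spectral radius ξ_1((T_{n,3}^{a,b})^c) is strictly decreasing in a; that is, ξ_1((T_{n,3}^{0,n−4})^c) > ξ_1((T_{n,3}^{1,n−5})^c) > … > ξ_1((T_{n,3}^{⌊(n−4)/2⌋,⌈(n−4)/2⌉})^c). -/
noncomputable section

open SimpleGraph

/-- The eccentricity of a vertex: the maximum distance to the other vertices. -/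
def ecc {n : ℕ} (G : SimpleGraph (Fin n)) (v : Fin n) : ℕ :=
  Finset.univ.sup fun u => G.dist v u

/-- The eccentricity matrix of a graph on `Fin n`: the `(u,v)` entry is
`d(u,v)` if `u ≠ v` and `d(u,v) = min (ecc u) (ecc v)`, and `0` otherwise. -/
def eccMatrix {n : ℕ} (G : SimpleGraph (Fin n)) : Matrix (Fin n) (Fin n) ℝ :=
  fun u v =>
    if u ≠ v ∧ G.dist u v = min (ecc G u) (ecc G v) then (G.dist u v : ℝ) else 0

/-- The multiset of eigenvalues of the eccentricity matrix (the roots of its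
characteristic polynomial, with multiplicity). -/
def eccEigs {n : ℕ} (G : SimpleGraph (Fin n)) : Multiset ℝ :=
  ((eccMatrix G).charpoly).roots

/-- The eigenvalues of the eccentricity matrix, listed in non-increasing order. -/
def eccEigList {n : ℕ} (G : SimpleGraph (Fin n)) : List ℝ :=
  ((eccEigs G).sort (· ≤ ·)).reverse

/-- `xi G k` is the `k`-th largest eigenvalue of the eccentricity matrix of `G`
(1-indexed, so `xi G 1` is the `𝓔`-spectral radius and `xi G n` is the least
`𝓔`-eigenvalue). -/
def xi {n : ℕ} (G : SimpleGraph (Fin n)) (k : ℕ) : ℝ :=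
  (eccEigList G).getD (k - 1) 0

/-- The eccentricity energy of `G`: the sum of the absolute values of the
eigenvalues of the eccentricity matrix. -/
def eccEnergy {n : ℕ} (G : SimpleGraph (Fin n)) : ℝ :=
  ((eccEigs G).map fun x => |x|).sum

/-- The star `K_{1,n-1}` on `Fin n`, centered at `0`. -/
def starGraph (n : ℕ) : SimpleGraph (Fin n) :=
  SimpleGraph.fromRel fun u _ => u.val = 0

/-- The diameter of a graph on `Fin n`. -/
def gdiam {n : ℕ} (G : SimpleGraph (Fin n)) : ℕ :=
  Finset.univ.sup fun p : Fin n × Fin n => G.dist p.1 p.2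

/-- The tree `T_{n,d}^{a,b}` (with `b = n - d - 1 - a`): a path `v₀v₁⋯v_d` with
`a` pendant vertices attached to `v₁` and the remaining `n - d - 1 - a` pendant
vertices attached to `v_{d-1}`.  Vertices `0,…,d` form the path, vertices
`d+1,…,d+a` are the pendants at `v₁`, and vertices `d+a+1,…,n-1` are the
pendants at `v_{d-1}`. -/
def Tnd (n d a : ℕ) : SimpleGraph (Fin n) :=
  SimpleGraph.fromRel fun u v =>
    (u.val + 1 = v.val ∧ v.val ≤ d) ∨
    (u.val = 1 ∧ d < v.val ∧ v.val ≤ d + a) ∨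
    (u.val = d - 1 ∧ d + a < v.val)

lemma xi_one_eq {n : ℕ} (G : SimpleGraph (Fin n)) (L : ℝ)
    (h1 : L ∈ eccEigs G) (h2 : ∀ m ∈ eccEigs G, m ≤ L) : xi G 1 = L := by
  unfold xi eccEigList
  have hp := Multiset.pairwise_sort (eccEigs G) (· ≤ ·)
  have hm : ∀ m, m ∈ (eccEigs G).sort (· ≤ ·) ↔ m ∈ eccEigs G := fun m => Multiset.mem_sort _
  generalize (eccEigs G).sort (· ≤ ·) = l at hp hm
  have hp' : l.reverse.Pairwise (fun a b => b ≤ a) := List.pairwise_reverse.2 hp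
  have hm' : ∀ m, m ∈ l.reverse ↔ m ∈ eccEigs G := by simpa using hm
  generalize l.reverse = r at hp' hm'
  cases r with
  | nil => exact absurd ((hm' L).2 h1) (by simp)
  | cons x t =>
    simp only [Nat.sub_self, List.getD_cons_zero]
    apply le_antisymm
    · exact h2 x ((hm' x).1 (by simp))
    · rcases List.mem_cons.1 ((hm' L).2 h1) with h | h
      · exact h.le
      · exact (List.pairwise_cons.1 hp').1 L h

lemma mem_eccEigs {n : ℕ} (G : SimpleGraph (Fin n)) (m : ℝ) :
    m ∈ eccEigs G ↔ ∃ x : Fin n → ℝ, x ≠ 0 ∧ ∀ u, ∑ v, eccMatrix G u v * x v = m * x u := by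
  unfold eccEigs
  rw [Polynomial.mem_roots (Matrix.charpoly_monic _).ne_zero, Polynomial.IsRoot.def,
    Matrix.eval_charpoly, ← Matrix.exists_mulVec_eq_zero_iff]
  apply exists_congr
  intro x
  apply and_congr Iff.rfl
  rw [Matrix.sub_mulVec, sub_eq_zero, funext_iff]
  apply forall_congr'
  intro u
  have : (Matrix.scalar (Fin n) m).mulVec x u = m * x u := by
    simp [Matrix.scalar_apply, Matrix.mulVec_diagonal]
  rw [this, eq_comm]
  rfl

/-- adjacency relation of the tree on values -/
def RR (a u v : ℕ) : Prop :=
    (u + 1 = v ∧ v ≤ 3) ∨ (u = 1 ∧ 3 < v ∧ v ≤ 3 + a) ∨ (u = 2 ∧ 3 + a < v)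

lemma adjC {n a : ℕ} (u v : Fin n) : ((Tnd n 3 a)ᶜ).Adj u v ↔
    u.val ≠ v.val ∧ ¬ RR a u.val v.val ∧ ¬ RR a v.val u.val := by
  simp only [Tnd, SimpleGraph.compl_adj, SimpleGraph.fromRel_adj, RR, ne_eq, Fin.ext_iff]
  tauto

lemma dist_two {n : ℕ} {G : SimpleGraph (Fin n)} {u v : Fin n} (w : Fin n) (hne : u ≠ v)
    (h : ¬ G.Adj u v) (h1 : G.Adj u w) (h2 : G.Adj w v) : G.dist u v = 2 := by
  have hle := SimpleGraph.dist_le (SimpleGraph.Walk.cons h1 (SimpleGraph.Walk.cons h2 .nil))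
  have hr : G.Reachable u v := ⟨SimpleGraph.Walk.cons h1 (SimpleGraph.Walk.cons h2 .nil)⟩
  have := hr.one_lt_dist_of_ne_of_not_adj hne h
  simp at hle
  omega

lemma dist_three {n : ℕ} {G : SimpleGraph (Fin n)} {u v : Fin n} (w z : Fin n) (hne : u ≠ v)
    (h : ¬ G.Adj u v) (hc : ∀ w, G.Adj u w → ¬ G.Adj w v)
    (h1 : G.Adj u w) (h2 : G.Adj w z) (h3 : G.Adj z v) : G.dist u v = 3 := by
  let p := SimpleGraph.Walk.cons h1 (SimpleGraph.Walk.cons h2 (SimpleGraph.Walk.cons h3 .nil))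
  have hle : G.dist u v ≤ 3 := SimpleGraph.dist_le p
  have hr : G.Reachable u v := ⟨p⟩
  have := hr.one_lt_dist_of_ne_of_not_adj hne h
  have h2 : G.dist u v ≠ 2 := by
    intro h2
    obtain ⟨q, hq⟩ := hr.exists_walk_length_eq_dist
    rw [h2] at hq
    cases q with
    | nil => simp at hq
    | cons e q =>
      cases q with
      | nil => simp at hq
      | cons e' q =>
        cases q with
        | nil => exact hc _ e e'
        | cons e'' q => simp at hq
  omega

lemma distC {n a : ℕ} (hn : 4 ≤ n) (u v : Fin n) :
    (((Tnd n 3 a)ᶜ).dist u v = 0 ∧ u.val = v.val) ∨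
    (((Tnd n 3 a)ᶜ).dist u v = 1 ∧ u.val ≠ v.val ∧ ¬ RR a u.val v.val ∧ ¬ RR a v.val u.val) ∨
    (((Tnd n 3 a)ᶜ).dist u v = 3 ∧ (u.val = 1 ∧ v.val = 2 ∨ u.val = 2 ∧ v.val = 1)) ∨
    (((Tnd n 3 a)ᶜ).dist u v = 2 ∧ u.val ≠ v.val ∧ (RR a u.val v.val ∨ RR a v.val u.val) ∧
      ¬ (u.val = 1 ∧ v.val = 2 ∨ u.val = 2 ∧ v.val = 1)) := by
  by_cases h0 : u = v
  · left; subst h0; simp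
  have h0' : u.val ≠ v.val := fun h => h0 (Fin.ext h)
  by_cases h1 : ((Tnd n 3 a)ᶜ).Adj u v
  · right; left
    exact ⟨SimpleGraph.dist_eq_one_iff_adj.2 h1, (adjC u v).1 h1⟩
  right; right
  have h1' := h1
  rw [adjC] at h1'
  by_cases h3 : (u.val = 1 ∧ v.val = 2 ∨ u.val = 2 ∧ v.val = 1)
  · left
    refine ⟨?_, h3⟩
    rcases h3 with h3 | h3
    · apply dist_three ⟨3, by omega⟩ ⟨0, by omega⟩ h0 h1
      · intro w; rw [adjC, adjC]; simp only [RR]; omega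
      all_goals rw [adjC]; simp only [RR]; omega
    · apply dist_three ⟨0, by omega⟩ ⟨3, by omega⟩ h0 h1
      · intro w; rw [adjC, adjC]; simp only [RR]; omega
      all_goals rw [adjC]; simp only [RR]; omega
  · right
    refine ⟨?_, h0', by by_contra hc; push Not at hc; exact h1' ⟨h0', hc⟩, h3⟩
    by_cases hh : u.val = 1 ∨ v.val = 1
    · apply dist_two ⟨3, by omega⟩ h0 h1
      all_goals rw [adjC]; simp only [RR] at *; omega
    · apply dist_two ⟨0, by omega⟩ h0 h1
      all_goals rw [adjC]; simp only [RR] at *; omega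

lemma eccC {n a : ℕ} (hn : 4 ≤ n) (u : Fin n) :
    ecc ((Tnd n 3 a)ᶜ) u = if u.val = 1 ∨ u.val = 2 then 3 else 2 := by
  unfold ecc
  apply le_antisymm
  · apply Finset.sup_le
    intro v _
    have := distC (a := a) hn u v
    split_ifs <;> omega
  · have key : ∀ w : Fin n, ((Tnd n 3 a)ᶜ).dist u w ≤
        Finset.univ.sup fun v => ((Tnd n 3 a)ᶜ).dist u v := fun w =>
      Finset.le_sup (f := fun v => ((Tnd n 3 a)ᶜ).dist u v) (Finset.mem_univ w)
    have k1 := key ⟨1, by omega⟩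
    have k2 := key ⟨2, by omega⟩
    have d1 := distC (a := a) hn u ⟨1, by omega⟩
    have d2 := distC (a := a) hn u ⟨2, by omega⟩
    simp only [RR, true_and, and_true] at d1 d2
    split_ifs
    all_goals omega

/-- leaves at vertex 1 -/
def LA (a u : ℕ) : Prop := u = 0 ∨ (3 < u ∧ u ≤ 3 + a)

instance (a u : ℕ) : Decidable (LA a u) := by unfold LA; infer_instance

/-- leaves at vertex 2 -/
def LB (a u : ℕ) : Prop := u = 3 ∨ 3 + a < u

instance (a u : ℕ) : Decidable (LB a u) := by unfold LB; infer_instance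

lemma cases4 (a u : ℕ) : u = 1 ∨ u = 2 ∨ LA a u ∨ LB a u := by
  simp only [LA, LB]; omega

lemma mat_eq {n a : ℕ} (hn : 4 ≤ n) (u v : Fin n) (k : ℕ)
    (hk : (k = 3 ∧ (u.val = 1 ∧ v.val = 2 ∨ u.val = 2 ∧ v.val = 1)) ∨
      (k = 2 ∧ (u.val = 1 ∧ LA a v ∨ v.val = 1 ∧ LA a u ∨ u.val = 2 ∧ LB a v ∨
        v.val = 2 ∧ LB a u)) ∨
      (k = 0 ∧ ¬ ((u.val = 1 ∧ v.val = 2 ∨ u.val = 2 ∧ v.val = 1)) ∧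
        ¬ (u.val = 1 ∧ LA a v ∨ v.val = 1 ∧ LA a u ∨ u.val = 2 ∧ LB a v ∨
        v.val = 2 ∧ LB a u))) :
    eccMatrix ((Tnd n 3 a)ᶜ) u v = k := by
  unfold eccMatrix
  rw [eccC hn, eccC hn]
  have hd := distC (a := a) hn u v
  simp only [RR, LA, LB, ne_eq, Fin.ext_iff] at *
  by_cases hu : u.val = 1 ∨ u.val = 2 <;> by_cases hv : v.val = 1 ∨ v.val = 2 <;>
    simp only [hu, hv, if_true, if_false] <;> split_ifs with h <;> norm_cast <;> omega

lemma row1 {n a : ℕ} (hn : 4 ≤ n) (u : Fin n) (hu : u.val = 1) (x : Fin n → ℝ) :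
    ∑ v, eccMatrix ((Tnd n 3 a)ᶜ) u v * x v =
      3 * x ⟨2, by omega⟩ + 2 * ∑ v with LA a v.val, x v := by
  have : ∀ v : Fin n, eccMatrix ((Tnd n 3 a)ᶜ) u v * x v =
      (if v = ⟨2, by omega⟩ then 3 * x v else 0) + (if LA a v.val then 2 * x v else 0) := by
    intro v
    simp only [Fin.ext_iff]
    by_cases h2 : v.val = 2
    · have : ¬ LA a v.val := by simp only [LA]; omega
      rw [mat_eq hn u v 3 (by simp only [true_and, and_true, true_or, or_true, LA, LB] at *; omega), if_pos h2, if_neg this]; simp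
    · by_cases h3 : LA a v.val
      · rw [mat_eq hn u v 2 (by simp only [true_and, and_true, true_or, or_true, LA, LB] at *; omega), if_neg h2, if_pos h3]; simp
      · rw [mat_eq hn u v 0 (by simp only [true_and, and_true, true_or, or_true, LA, LB] at *; omega), if_neg h2, if_neg h3]; simp
  simp_rw [this]
  rw [Finset.sum_add_distrib, Finset.sum_ite_eq', Finset.mul_sum, Finset.sum_filter]
  simp

lemma row2 {n a : ℕ} (hn : 4 ≤ n) (u : Fin n) (hu : u.val = 2) (x : Fin n → ℝ) :
    ∑ v, eccMatrix ((Tnd n 3 a)ᶜ) u v * x v =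
      3 * x ⟨1, by omega⟩ + 2 * ∑ v with LB a v.val, x v := by
  have : ∀ v : Fin n, eccMatrix ((Tnd n 3 a)ᶜ) u v * x v =
      (if v = ⟨1, by omega⟩ then 3 * x v else 0) + (if LB a v.val then 2 * x v else 0) := by
    intro v
    simp only [Fin.ext_iff]
    by_cases h2 : v.val = 1
    · have : ¬ LB a v.val := by simp only [LB]; omega
      rw [mat_eq hn u v 3 (by simp only [true_and, and_true, true_or, or_true, LA, LB] at *; omega), if_pos h2, if_neg this]; simp
    · by_cases h3 : LB a v.val
      · rw [mat_eq hn u v 2 (by simp only [true_and, and_true, true_or, or_true, LA, LB] at *; omega), if_neg h2, if_pos h3]; simp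
      · rw [mat_eq hn u v 0 (by simp only [true_and, and_true, true_or, or_true, LA, LB] at *; omega), if_neg h2, if_neg h3]; simp
  simp_rw [this]
  rw [Finset.sum_add_distrib, Finset.sum_ite_eq', Finset.mul_sum, Finset.sum_filter]
  simp

lemma rowA {n a : ℕ} (hn : 4 ≤ n) (u : Fin n) (hu : LA a u.val) (x : Fin n → ℝ) :
    ∑ v, eccMatrix ((Tnd n 3 a)ᶜ) u v * x v = 2 * x ⟨1, by omega⟩ := by
  rw [Finset.sum_eq_single ⟨1, by omega⟩]
  · rw [mat_eq hn u _ 2 (by simp only [true_and, and_true, true_or, or_true, LA, LB] at *; omega)]; simp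
  · intro v _ hv
    rw [mat_eq hn u v 0 (by simp only [true_and, and_true, true_or, or_true, LA, LB, ne_eq, Fin.ext_iff] at *; omega)]; simp
  · simp

lemma rowB {n a : ℕ} (hn : 4 ≤ n) (u : Fin n) (hu : LB a u.val) (x : Fin n → ℝ) :
    ∑ v, eccMatrix ((Tnd n 3 a)ᶜ) u v * x v = 2 * x ⟨2, by omega⟩ := by
  rw [Finset.sum_eq_single ⟨2, by omega⟩]
  · rw [mat_eq hn u _ 2 (by simp only [true_and, and_true, true_or, or_true, LA, LB] at *; omega)]; simp
  · intro v _ hv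
    rw [mat_eq hn u v 0 (by simp only [true_and, and_true, true_or, or_true, LA, LB, ne_eq, Fin.ext_iff] at *; omega)]; simp
  · simp

lemma cardA {n a : ℕ} (hn : 4 + a ≤ n) :
    (Finset.univ.filter fun v : Fin n => LA a v.val).card = a + 1 := by
  have : ((Finset.univ.filter fun v : Fin n => LA a v.val).map Fin.valEmbedding) =
      insert 0 (Finset.Ioc 3 (3 + a)) := by
    ext k
    simp only [Finset.mem_map, Finset.mem_filter, Finset.mem_univ, true_and, Fin.valEmbedding_apply,
      Finset.mem_insert, Finset.mem_Ioc]
    unfold LA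
    constructor
    · rintro ⟨v, hv, rfl⟩; exact hv
    · intro h; exact ⟨⟨k, by omega⟩, h, rfl⟩
  rw [← Finset.card_map Fin.valEmbedding, this, Finset.card_insert_of_notMem (by simp)]
  simp

lemma cardB {n a : ℕ} (hn : 4 + a ≤ n) :
    (Finset.univ.filter fun v : Fin n => LB a v.val).card = n - 3 - a := by
  have : ((Finset.univ.filter fun v : Fin n => LB a v.val).map Fin.valEmbedding) =
      insert 3 (Finset.Ioo (3 + a) n) := by
    ext k
    simp only [Finset.mem_map, Finset.mem_filter, Finset.mem_univ, true_and, Fin.valEmbedding_apply,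
      Finset.mem_insert, Finset.mem_Ioo]
    unfold LB
    constructor
    · rintro ⟨v, hv, rfl⟩; have := v.2; omega
    · intro h; exact ⟨⟨k, by omega⟩, by simp only; omega, rfl⟩
  rw [← Finset.card_map Fin.valEmbedding, this, Finset.card_insert_of_notMem (by simp)]
  simp
  omega

lemma eig_iff {n a : ℕ} (hn : 4 + a ≤ n) (m : ℝ) (hm : 0 < m) (p q : ℝ) (hp : p = a + 1)
    (hq : q = n - 3 - a) :
    m ∈ eccEigs ((Tnd n 3 a)ᶜ) ↔ (m ^ 2 - 4 * p) * (m ^ 2 - 4 * q) = 9 * m ^ 2 := by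
  have hn4 : 4 ≤ n := by omega
  have hp0 : 0 < p := by rw [hp]; positivity
  have cA : ((Finset.univ.filter fun v : Fin n => LA a v.val).card : ℝ) = p := by
    rw [cardA hn, hp]; push_cast; ring
  have cB : ((Finset.univ.filter fun v : Fin n => LB a v.val).card : ℝ) = q := by
    rw [cardB hn, hq, Nat.cast_sub (by omega), Nat.cast_sub (by omega)]; push_cast; ring
  rw [mem_eccEigs]
  constructor
  · rintro ⟨x, hx, h⟩
    set x1 := x ⟨1, by omega⟩ with hx1
    set x2 := x ⟨2, by omega⟩ with hx2
    have hA : ∀ u : Fin n, LA a u.val → x u = 2 * x1 / m := by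
      intro u hu
      have := h u
      rw [rowA hn4 u hu] at this
      rw [eq_div_iff hm.ne']; linarith
    have hB : ∀ u : Fin n, LB a u.val → x u = 2 * x2 / m := by
      intro u hu
      have := h u
      rw [rowB hn4 u hu] at this
      rw [eq_div_iff hm.ne']; linarith
    have e1 := h ⟨1, by omega⟩
    rw [row1 hn4 _ rfl, Finset.sum_congr rfl (fun u hu => hA u (Finset.mem_filter.1 hu).2),
      Finset.sum_const, nsmul_eq_mul, cA, ← hx1, ← hx2] at e1
    have e2 := h ⟨2, by omega⟩
    rw [row2 hn4 _ rfl, Finset.sum_congr rfl (fun u hu => hB u (Finset.mem_filter.1 hu).2),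
      Finset.sum_const, nsmul_eq_mul, cB, ← hx1, ← hx2] at e2
    field_simp at e1 e2
    have f1 : (m ^ 2 - 4 * p) * x1 = 3 * m * x2 := by linarith
    have f2 : (m ^ 2 - 4 * q) * x2 = 3 * m * x1 := by linarith
    by_cases h1 : x1 = 0
    · have h2 : x2 = 0 := by
        rw [h1, mul_zero] at f1
        have := f1.symm
        simpa [hm.ne'] using this
      exfalso
      apply hx
      funext u
      rcases cases4 a u.val with hu | hu | hu | hu
      · rw [show u = ⟨1, by omega⟩ from Fin.ext hu]; exact h1
      · rw [show u = ⟨2, by omega⟩ from Fin.ext hu]; exact h2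
      · rw [hA u hu, h1]; simp
      · rw [hB u hu, h2]; simp
    · apply mul_right_cancel₀ h1
      calc (m ^ 2 - 4 * p) * (m ^ 2 - 4 * q) * x1
          = (m ^ 2 - 4 * q) * ((m ^ 2 - 4 * p) * x1) := by ring
        _ = 3 * m * ((m ^ 2 - 4 * q) * x2) := by rw [f1]; ring
        _ = _ := by rw [f2]; ring
  · intro h
    refine ⟨fun u => if u.val = 1 then 3 * m ^ 2 else if u.val = 2 then m * (m ^ 2 - 4 * p) else
      if LA a u.val then 6 * m else 2 * (m ^ 2 - 4 * p), ?_, ?_⟩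
    · intro h0
      have := congrFun h0 ⟨1, by omega⟩
      simp [hm.ne'] at this
    · intro u
      rcases cases4 a u.val with hu | hu | hu | hu
      · rw [row1 hn4 u hu, Finset.sum_congr rfl (g := fun _ => 6 * m), Finset.sum_const,
          nsmul_eq_mul, cA]
        · simp [hu]; ring
        · intro v hv
          have hv := (Finset.mem_filter.1 hv).2
          rw [if_neg (by simp only [LA] at hv; omega), if_neg (by simp only [LA] at hv; omega),
            if_pos hv]
      · rw [row2 hn4 u hu, Finset.sum_congr rfl (g := fun _ => 2 * (m ^ 2 - 4 * p)),
          Finset.sum_const, nsmul_eq_mul, cB]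
        · simp [hu]; linarith
        · intro v hv
          have hv := (Finset.mem_filter.1 hv).2
          rw [if_neg (by simp only [LB] at hv; omega), if_neg (by simp only [LB] at hv; omega),
            if_neg (by simp only [LB, LA] at *; omega)]
      · rw [rowA hn4 u hu]
        simp only [if_pos hu, if_true]
        rw [if_neg (by simp only [LA] at hu; omega), if_neg (by simp only [LA] at hu; omega)]
        ring
      · rw [rowB hn4 u hu]
        simp only
        rw [if_neg (by simp), if_pos trivial, if_neg (by simp only [LB] at hu; omega),
          if_neg (by simp only [LB] at hu; omega), if_neg (by simp only [LB, LA] at *; omega)]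
        ring

lemma xi_val {n a : ℕ} (hn : 4 + a ≤ n) (p q : ℝ) (hp : p = a + 1)
    (hq : q = n - 3 - a) :
    xi ((Tnd n 3 a)ᶜ) 1 =
      √((4 * (p + q) + 9 + √((4 * (p + q) + 9) ^ 2 - 64 * (p * q))) / 2) := by
  have hp0 : 0 < p := by rw [hp]; positivity
  have hq0 : 0 < q := by
    have : (4 + a : ℝ) ≤ n := by exact_mod_cast hn
    rw [hq]; linarith
  have hD : 0 ≤ (4 * (p + q) + 9) ^ 2 - 64 * (p * q) := by nlinarith [sq_nonneg (p - q)]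
  set D := √((4 * (p + q) + 9) ^ 2 - 64 * (p * q)) with hDd
  have hD0 : 0 ≤ D := Real.sqrt_nonneg _
  have hDs : D ^ 2 = (4 * (p + q) + 9) ^ 2 - 64 * (p * q) := Real.sq_sqrt hD
  have ht : 0 < (4 * (p + q) + 9 + D) / 2 := by positivity
  apply xi_one_eq
  · rw [eig_iff hn _ (Real.sqrt_pos.2 ht) p q hp hq, Real.sq_sqrt ht.le]
    nlinarith
  · intro m hm
    by_cases h0 : 0 < m
    · rw [eig_iff hn m h0 p q hp hq] at hm
      apply Real.le_sqrt_of_sq_le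
      by_contra hc
      push Not at hc
      have : (2 * m ^ 2 - (4 * (p + q) + 9)) ^ 2 = D ^ 2 := by rw [hDs]; linarith
      nlinarith
    · exact (not_lt.1 h0).trans (Real.sqrt_nonneg _)

/-- Theorem 3.1: the `𝓔`-spectral radius of `(T_{n,3}^{a,n-4-a})ᶜ` is strictly
decreasing in `a` for `0 ≤ a ≤ ⌊(n-4)/2⌋`. -/
theorem stmt_1 {n : ℕ} (hn : 4 ≤ n) :
    StrictAntiOn (fun a : ℕ => xi ((Tnd n 3 a)ᶜ) 1) (Set.Iic ((n - 4) / 2)) := by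
  intro a ha b hb hab
  simp only [Set.mem_Iic] at ha hb
  have hna : 4 + a ≤ n := by omega
  have hnb : 4 + b ≤ n := by omega
  have h2 : (2 * b + 4 : ℝ) ≤ n := by
    have : 2 * b + 4 ≤ n := by omega
    exact_mod_cast this
  have hab' : (a : ℝ) < b := by exact_mod_cast hab
  have ha0 : (0 : ℝ) ≤ a := Nat.cast_nonneg a
  simp only
  rw [xi_val hna _ _ rfl rfl, xi_val hnb _ _ rfl rfl]
  have hs : ∀ c : ℝ, c + 1 + ((n : ℝ) - 3 - c) = n - 2 := fun c => by ring
  rw [hs, hs]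
  apply Real.sqrt_lt_sqrt (by have : (0:ℝ) ≤ n - 2 := by linarith
                              positivity)
  have : √((4 * ((n : ℝ) - 2) + 9) ^ 2 - 64 * ((b + 1) * (n - 3 - b))) <
      √((4 * ((n : ℝ) - 2) + 9) ^ 2 - 64 * ((a + 1) * (n - 3 - a))) := by
    apply Real.sqrt_lt_sqrt
    · nlinarith [sq_nonneg (((b : ℝ) + 1) - (n - 3 - b))]
    · nlinarith [mul_pos (sub_pos.2 hab') (show (0 : ℝ) < n - 4 - a - b by linarith)]
  linarith
end
end

section
/- Let n ≥ 4. For integers a with 0 ≤ a ≤ ⌊(n−4)/2⌋ set b = n − 4 − a. Then the second largest 𝓔-eigenvalue ξ_2((T_{n,3}^{a,b})^c) = sqrt((4n+1 − sqrt((4n+1)^2 − 64(a+1)(b+1)))/2) is strictly increasing in a; that is, ξ_2((T_{n,3}^{0,n−4})^c) < ξ_2((T_{n,3}^{1,n−5})^c) < … < ξ_2((T_{n,3}^{⌊(n−4)/2⌋,⌈(n−4)/2⌉})^c). -/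
noncomputable section

open SimpleGraph

lemma aux_adj {n a : ℕ} (u v : Fin n) : (Tnd n 3 a)ᶜ.Adj u v ↔ (u.val ≠ v.val ∧
   ¬ ((u.val + 1 = v.val ∧ v.val ≤ 3) ∨ (u.val = 1 ∧ 3 < v.val ∧ v.val ≤ 3 + a) ∨
    (u.val = 2 ∧ 3 + a < v.val)) ∧ ¬ ((v.val + 1 = u.val ∧ u.val ≤ 3) ∨ (v.val = 1 ∧ 3 < u.val ∧ u.val ≤ 3 + a) ∨
    (v.val = 2 ∧ 3 + a < u.val))) := by
  simp only [Tnd, SimpleGraph.compl_adj, SimpleGraph.fromRel_adj, ne_eq, Fin.ext_iff]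
  tauto

lemma aux_pot {V : Type*} {G : SimpleGraph V} (f : V → ℕ) (h : ∀ u v, G.Adj u v → f v ≤ f u + 1)
    {u v : V} (w : G.Walk u v) : f v ≤ f u + w.length := by
  induction w with
  | nil => simp
  | cons e w ih => have := h _ _ e; simp only [SimpleGraph.Walk.length_cons]; omega

lemma aux_le2 {V : Type*} {G : SimpleGraph V} {u v w : V} (h : G.Adj u v) (h' : G.Adj v w) :
    G.dist u w ≤ 2 := by
  simpa using SimpleGraph.dist_le (.cons h (.cons h' .nil))

lemma aux_d12 {n a : ℕ} (hn : 4 ≤ n) : (Tnd n 3 a)ᶜ.dist (⟨1, by omega⟩ : Fin n) ⟨2, by omega⟩ = 3 := by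
  apply le_antisymm
  · have h1 : (Tnd n 3 a)ᶜ.Adj (⟨1, by omega⟩ : Fin n) ⟨3, by omega⟩ := by rw [aux_adj]; simp
    have h2 : (Tnd n 3 a)ᶜ.Adj (⟨3, by omega⟩ : Fin n) ⟨0, by omega⟩ := by rw [aux_adj]; simp
    have h3 : (Tnd n 3 a)ᶜ.Adj (⟨0, by omega⟩ : Fin n) ⟨2, by omega⟩ := by rw [aux_adj]; simp
    simpa using SimpleGraph.dist_le (.cons h1 (.cons h2 (.cons h3 .nil)))
  · have h1 : (Tnd n 3 a)ᶜ.Adj (⟨1, by omega⟩ : Fin n) ⟨3, by omega⟩ := by rw [aux_adj]; simp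
    have h2 : (Tnd n 3 a)ᶜ.Adj (⟨3, by omega⟩ : Fin n) ⟨0, by omega⟩ := by rw [aux_adj]; simp
    have h3 : (Tnd n 3 a)ᶜ.Adj (⟨0, by omega⟩ : Fin n) ⟨2, by omega⟩ := by rw [aux_adj]; simp
    have hr := (h1.reachable.trans h2.reachable).trans h3.reachable
    obtain ⟨w, hw⟩ := hr.exists_walk_length_eq_dist
    have := aux_pot (fun v : Fin n => if v.val = 1 then 0 else if v.val = 2 then 3 else
      if v.val = 3 ∨ 3 + a < v.val then 1 else 2) (by
        intro u v h
        rw [aux_adj] at h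
        grind) w
    rw [hw] at this
    simpa using this

/-- explicit distance -/
def fd (a u v : ℕ) : ℕ := if u = v then 0 else
  if (u = 1 ∧ v = 2) ∨ (u = 2 ∧ v = 1) then 3 else
  if (u = 1 ∧ (v = 0 ∨ (3 < v ∧ v ≤ 3 + a))) ∨ (v = 1 ∧ (u = 0 ∨ (3 < u ∧ u ≤ 3 + a))) ∨
     (u = 2 ∧ (v = 3 ∨ 3 + a < v)) ∨ (v = 2 ∧ (u = 3 ∨ 3 + a < u)) then 2 else 1

lemma aux_dist {n a : ℕ} (hn : 4 ≤ n) (u v : Fin n) : (Tnd n 3 a)ᶜ.dist u v = fd a u v := by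
  unfold fd
  split_ifs with h1 h2 h3
  · rw [Fin.ext h1, SimpleGraph.dist_self]
  · rcases h2 with ⟨h, h'⟩ | ⟨h, h'⟩
    · rw [show u = ⟨1, by omega⟩ from Fin.ext h, show v = ⟨2, by omega⟩ from Fin.ext h']
      exact aux_d12 hn
    · rw [show u = ⟨2, by omega⟩ from Fin.ext h, show v = ⟨1, by omega⟩ from Fin.ext h',
        SimpleGraph.dist_comm]
      exact aux_d12 hn
  · have hna : ¬ (Tnd n 3 a)ᶜ.Adj u v := by
      rw [aux_adj]; omega
    obtain ⟨w, hw1, hw2⟩ : ∃ w, (Tnd n 3 a)ᶜ.Adj u w ∧ (Tnd n 3 a)ᶜ.Adj w v := by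
      by_cases h : u.val = 1 ∨ v.val = 1
      · refine ⟨⟨3, by omega⟩, ?_, ?_⟩ <;> rw [aux_adj] <;> dsimp only <;> omega
      · refine ⟨⟨0, by omega⟩, ?_, ?_⟩ <;> rw [aux_adj] <;> dsimp only <;> omega
    apply le_antisymm (aux_le2 hw1 hw2)
    have := (hw1.reachable.trans hw2.reachable).one_lt_dist_of_ne_of_not_adj
      (fun h => h1 (congrArg _ h)) hna
    omega
  · rw [SimpleGraph.dist_eq_one_iff_adj, aux_adj]
    omega

lemma aux_ecc {n a : ℕ} (hn : 4 ≤ n) (u : Fin n) :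
    ecc (Tnd n 3 a)ᶜ u = if u.val = 1 ∨ u.val = 2 then 3 else 2 := by
  unfold ecc
  apply le_antisymm
  · apply Finset.sup_le
    intro v _
    rw [aux_dist hn]
    unfold fd
    grind
  · have key : ∀ v : Fin n, fd a u v ≤ Finset.univ.sup fun v => (Tnd n 3 a)ᶜ.dist u v := by
      intro v
      rw [← aux_dist hn]
      exact Finset.le_sup (f := fun v => (Tnd n 3 a)ᶜ.dist u v) (Finset.mem_univ v)
    have k1 := key ⟨1, by omega⟩
    have k2 := key ⟨2, by omega⟩
    simp only [fd] at k1 k2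
    grind

lemma aux_mat {n a : ℕ} (hn : 4 ≤ n) (u v : Fin n) :
    eccMatrix (Tnd n 3 a)ᶜ u v = if (u.val = 1 ∧ v.val = 2) ∨ (u.val = 2 ∧ v.val = 1) then 3 else
  if (u.val = 1 ∧ (v.val = 0 ∨ (3 < v.val ∧ v.val ≤ 3 + a))) ∨ (v.val = 1 ∧ (u.val = 0 ∨ (3 < u.val ∧ u.val ≤ 3 + a))) ∨
     (u.val = 2 ∧ (v.val = 3 ∨ 3 + a < v.val)) ∨ (v.val = 2 ∧ (u.val = 3 ∨ 3 + a < u.val)) then 2 else 0 := by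
  unfold eccMatrix
  rw [aux_dist hn, aux_ecc hn, aux_ecc hn]
  simp only [ne_eq, Fin.ext_iff, fd]
  by_cases h1 : u.val = v.val
  · simp only [h1, not_true, false_and, if_false]
    rw [if_neg (by omega), if_neg (by omega)]
  by_cases h2 : (u.val = 1 ∧ v.val = 2) ∨ (u.val = 2 ∧ v.val = 1)
  · rw [if_neg h1, if_pos h2, if_pos h2, if_pos (c := u.val = 1 ∨ u.val = 2) (by omega), if_pos (c := v.val = 1 ∨ v.val = 2) (by omega)]
    simp [h1]
  rw [if_neg h1, if_neg h2, if_neg h2]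
  split_ifs <;> first | norm_num | (exfalso; omega) | skip
  all_goals (simp_all; try omega)

lemma aux_sum (a b : ℕ) (f : ℕ → ℝ) (c d : ℝ) (hc : ∀ i, 3 < i → i ≤ 3 + a → f i = c)
    (hd : ∀ i, 3 + a < i → f i = d) :
    ∑ i : Fin (4 + a + b), f i = f 0 + f 1 + f 2 + f 3 + a * c + b * d := by
  rw [Fin.sum_univ_eq_sum_range, Finset.sum_range_add, Finset.sum_range_add]
  rw [Finset.sum_congr rfl (g := fun _ => c) (s₁ := Finset.range a), Finset.sum_congr rfl (g := fun _ => d) (s₁ := Finset.range b)]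
  · simp [Finset.sum_range_succ]
  · intro i hi; exact hd _ (by omega)
  · intro i hi; rw [Finset.mem_range] at hi; exact hc _ (by omega) (by omega)

def f1 (i : ℕ) : ℝ := if i = 1 then 1 else 0
def fu (a i : ℕ) : ℝ := if i = 2 then 3 else if i = 0 ∨ (3 < i ∧ i ≤ 3 + a) then 2 else 0
def f2 (i : ℕ) : ℝ := if i = 2 then 1 else 0
def fw (a i : ℕ) : ℝ := if i = 3 ∨ 3 + a < i then 2 else 0

def Um (a n : ℕ) : Matrix (Fin n) (Fin 4) ℝ := fun i => ![f1 i, fu a i, f2 i, fw a i]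
def Vm (a n : ℕ) : Matrix (Fin 4) (Fin n) ℝ := fun k i => ![fu a i, f1 i, fw a i, f2 i] k

lemma aux_UV {n a : ℕ} (hn : 4 ≤ n) : eccMatrix (Tnd n 3 a)ᶜ = Um a n * Vm a n := by
  ext u v
  rw [aux_mat hn, Matrix.mul_apply]
  simp only [Um, Vm, Fin.sum_univ_four, Matrix.cons_val, f1, f2, fu, fw]
  have h31 : ¬ (3 + a ≤ 1) := by omega
  by_cases u1 : u.val = 1
  · simp only [u1]
    by_cases v2 : v.val = 2
    · simp [v2]
    · simp [v2]
  by_cases u2 : u.val = 2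
  · simp only [u2]
    by_cases v1 : v.val = 1
    · simp [v1]
    · simp [v1, h31]
  by_cases v1 : v.val = 1
  · simp [v1, u1, u2]
  by_cases v2 : v.val = 2
  · simp [v2, u1, u2]
  simp [u1, u2, v1, v2]

lemma aux_VU (a b : ℕ) : Vm a (4 + a + b) * Um a (4 + a + b) =
    !![0, 4 * ((a:ℝ) + 1) + 9, 3, 0; 1, 0, 0, 0; 0, 0, 0, 4 * ((b:ℝ) + 1); 0, 3, 1, 0] := by
  have key : ∀ (g h : ℕ → ℝ) (c d c' d' : ℝ), (∀ i, 3 < i → i ≤ 3 + a → g i = c) →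
      (∀ i, 3 + a < i → g i = d) → (∀ i, 3 < i → i ≤ 3 + a → h i = c') →
      (∀ i, 3 + a < i → h i = d') → ∑ i : Fin (4 + a + b), g i * h i =
       g 0 * h 0 + g 1 * h 1 + g 2 * h 2 + g 3 * h 3 + a * (c * c') + b * (d * d') := by
    intro g h c d c' d' h1 h2 h3 h4
    apply aux_sum a b (fun i => g i * h i)
    · intro i hi hi'; simp only [h1 i hi hi', h3 i hi hi']
    · intro i hi; simp only [h2 i hi, h4 i hi]
  have p1 : ∀ i, 3 < i → i ≤ 3 + a → f1 i = 0 := by intro i h h'; simp [f1]; omega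
  have p2 : ∀ i, 3 + a < i → f1 i = 0 := by intro i h; simp [f1]; omega
  have q1 : ∀ i, 3 < i → i ≤ 3 + a → f2 i = 0 := by intro i h h'; simp [f2]; omega
  have q2 : ∀ i, 3 + a < i → f2 i = 0 := by intro i h; simp [f2]; omega
  have r1 : ∀ i, 3 < i → i ≤ 3 + a → fu a i = 2 := by
    intro i h h'; unfold fu; rw [if_neg (by omega), if_pos (by omega)]
  have r2 : ∀ i, 3 + a < i → fu a i = 0 := by
    intro i h; unfold fu; rw [if_neg (by omega), if_neg (by omega)]
  have s1 : ∀ i, 3 < i → i ≤ 3 + a → fw a i = 0 := by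
    intro i h h'; unfold fw; rw [if_neg (by omega)]
  have s2 : ∀ i, 3 + a < i → fw a i = 2 := by
    intro i h; unfold fw; rw [if_pos (by omega)]
  have h31 : 1 < 3 + a := by omega
  have h32 : ¬ (3 + a ≤ 1) := by omega
  ext i j
  rw [Matrix.mul_apply]
  fin_cases i <;> fin_cases j <;> simp only [Um, Vm, Fin.reduceFinMk, Fin.zero_eta, Fin.mk_one, Matrix.cons_val, Matrix.of_apply]
  · rw [key _ _ _ _ _ _ r1 r2 p1 p2]; simp [f1, fu]
  · rw [key _ _ _ _ _ _ r1 r2 r1 r2]; simp [fu]; ring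
  · rw [key _ _ _ _ _ _ r1 r2 q1 q2]; simp [f2, fu]
  · rw [key _ _ _ _ _ _ r1 r2 s1 s2]; simp [fw, fu, h31, h32]
  · rw [key _ _ _ _ _ _ p1 p2 p1 p2]; simp [f1]
  · rw [key _ _ _ _ _ _ p1 p2 r1 r2]; simp [f1, fu]
  · rw [key _ _ _ _ _ _ p1 p2 q1 q2]; simp [f1, f2]
  · rw [key _ _ _ _ _ _ p1 p2 s1 s2]; simp [f1, fw]
  · rw [key _ _ _ _ _ _ s1 s2 p1 p2]; simp [f1, fw]
  · rw [key _ _ _ _ _ _ s1 s2 r1 r2]; simp [fw, fu, h31, h32]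
  · rw [key _ _ _ _ _ _ s1 s2 q1 q2]; simp [fw, f2, h31, h32]
  · rw [key _ _ _ _ _ _ s1 s2 s1 s2]; simp [fw, h31, h32]; ring
  · rw [key _ _ _ _ _ _ q1 q2 p1 p2]; simp [f1, f2]
  · rw [key _ _ _ _ _ _ q1 q2 r1 r2]; simp [f2, fu]
  · rw [key _ _ _ _ _ _ q1 q2 q1 q2]; simp [f2]
  · rw [key _ _ _ _ _ _ q1 q2 s1 s2]; simp [f2, fw, h31, h32]

open Polynomial in
lemma aux_cp4 (p q : ℝ) : (!![0, p, 3, 0; 1, 0, 0, 0; 0, 0, 0, q; 0, 3, 1, 0] : Matrix (Fin 4) (Fin 4) ℝ).charpoly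
    = X ^ 4 - C (p + q) * X ^ 2 + C ((p - 9) * q) := by
  rw [Matrix.charpoly, Matrix.charmatrix]
  simp [Matrix.det_succ_row_zero, Fin.sum_univ_succ, Fin.succAbove, Matrix.submatrix, Matrix.diagonal]
  have : (C (3:ℝ) : ℝ[X]) = 3 := rfl
  have : (C (9:ℝ) : ℝ[X]) = 9 := rfl
  simp [*]
  ring

open Polynomial in
lemma aux_cp (a b : ℕ) : (eccMatrix (Tnd (4 + a + b) 3 a)ᶜ).charpoly =
   X ^ (a + b) * (X ^ 4 - C (4 * ((4 + a + b : ℕ) : ℝ) + 1) * X ^ 2 + C (16 * ((a : ℝ) + 1) * ((b:ℝ) + 1))) := by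
  rw [aux_UV (by omega), Matrix.charpoly_mul_comm_of_le _ _ (by simp; omega), aux_VU, aux_cp4]
  congr 2
  · simp; omega
  · congr 3; push_cast; ring
  · ring

open Polynomial in
lemma aux_xi (a b : ℕ) (r s : ℝ) (h0 : 0 < s) (hsr : s ≤ r)
    (h1 : r ^ 2 + s ^ 2 = 4 * ((4 + a + b : ℕ) : ℝ) + 1)
    (h2 : r ^ 2 * s ^ 2 = 16 * ((a : ℝ) + 1) * ((b:ℝ) + 1)) :
    xi (Tnd (4 + a + b) 3 a)ᶜ 2 = s := by
  have hcp : (eccMatrix (Tnd (4 + a + b) 3 a)ᶜ).charpoly =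
      ((((r ::ₘ s ::ₘ (Multiset.replicate (a + b) 0 + {-s, -r}) : Multiset ℝ)).map fun t => X - C t)).prod := by
    rw [aux_cp, ← h1, ← h2]
    simp
    ring
  have hroots : eccEigs (Tnd (4 + a + b) 3 a)ᶜ = r ::ₘ s ::ₘ (Multiset.replicate (a + b) 0 + {-s, -r}) := by
    unfold eccEigs
    rw [hcp, roots_multiset_prod_X_sub_C]
  have hl : eccEigList (Tnd (4 + a + b) 3 a)ᶜ = r :: s :: (List.replicate (a + b) 0 ++ [-s, -r]) := by
    unfold eccEigList
    apply List.Perm.eq_of_pairwise' (r := (· ≥ ·))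
    · rw [List.pairwise_reverse]
      exact Multiset.pairwise_sort _ _
    · simp only [List.pairwise_cons, List.pairwise_append, List.mem_append, List.mem_replicate, List.mem_cons, List.pairwise_replicate]
      simp
      grind
    · rw [← Multiset.coe_eq_coe, Multiset.coe_reverse, Multiset.sort_eq, hroots]
      rfl
  simp [xi, hl]

lemma aux_formula {n a : ℕ} (hn : 4 ≤ n) (ha : a ≤ (n - 4) / 2) :
      xi ((Tnd n 3 a)ᶜ) 2 =
        Real.sqrt ((4 * (n : ℝ) + 1 -
          Real.sqrt ((4 * (n : ℝ) + 1) ^ 2 -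
            64 * ((a : ℝ) + 1) * ((n : ℝ) - 3 - (a : ℝ)))) / 2) := by
  obtain ⟨b, rfl⟩ : ∃ b, n = 4 + a + b := ⟨n - 4 - a, by omega⟩
  set N : ℝ := ((4 + a + b : ℕ) : ℝ) with hN
  have hN' : N = 4 + a + b := by rw [hN]; push_cast; ring
  have ha0 : (0:ℝ) ≤ a := by positivity
  have hb0 : (0:ℝ) ≤ b := by positivity
  have hab : 0 ≤ (a:ℝ) * b := by positivity
  set D := (4 * N + 1) ^ 2 - 64 * ((a : ℝ) + 1) * (N - 3 - (a : ℝ)) with hD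
  have hD0 : 0 ≤ D := by rw [hD, hN']; nlinarith [sq_nonneg ((a:ℝ) - b)]
  have hDlt : Real.sqrt D < 4 * N + 1 := by
    rw [Real.sqrt_lt' (by rw [hN']; positivity), hD, hN']
    nlinarith
  have hs := Real.sqrt_nonneg D
  have hDs := Real.sq_sqrt hD0
  have e1 := Real.sq_sqrt (show 0 ≤ (4 * N + 1 + Real.sqrt D) / 2 by linarith)
  have e2 := Real.sq_sqrt (show 0 ≤ (4 * N + 1 - Real.sqrt D) / 2 by linarith)
  apply aux_xi a b (Real.sqrt ((4 * N + 1 + Real.sqrt D) / 2))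
  · apply Real.sqrt_pos.2; linarith
  · apply Real.sqrt_le_sqrt; linarith
  · rw [e1, e2]; ring
  · rw [e1, e2]
    have : (4 * N + 1 + √D) / 2 * ((4 * N + 1 - √D) / 2) = ((4 * N + 1) ^ 2 - √D ^ 2) / 4 := by ring
    rw [this, hDs, hD, hN']; ring

theorem stmt_8 {n : ℕ} (hn : 4 ≤ n) :
    (∀ a ≤ (n - 4) / 2,
      xi ((Tnd n 3 a)ᶜ) 2 =
        Real.sqrt ((4 * (n : ℝ) + 1 -
          Real.sqrt ((4 * (n : ℝ) + 1) ^ 2 -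
            64 * ((a : ℝ) + 1) * ((n : ℝ) - 3 - (a : ℝ)))) / 2)) ∧
    StrictMonoOn (fun a : ℕ => xi ((Tnd n 3 a)ᶜ) 2) (Set.Iic ((n - 4) / 2)) := by
  refine ⟨fun a ha => aux_formula hn ha, ?_⟩
  intro a ha b hb hab
  simp only [Set.mem_Iic] at ha hb
  simp only [aux_formula hn ha, aux_formula hn hb]
  have h1 : (a:ℝ) + 1 ≤ b := by exact_mod_cast hab
  have h2 : 2 * (b:ℝ) + 4 ≤ n := by exact_mod_cast (by omega : 2 * b + 4 ≤ n)
  have ha0 : (0:ℝ) ≤ a := by positivity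
  have key : ((a : ℝ) + 1) * ((n : ℝ) - 3 - (a : ℝ)) < ((b : ℝ) + 1) * ((n : ℝ) - 3 - (b : ℝ)) := by
    nlinarith [mul_pos (show 0 < (b:ℝ) - a by linarith) (show 0 < (n:ℝ) - 4 - a - b by linarith)]
  have hb0 : 0 ≤ (4 * (n:ℝ) + 1) ^ 2 - 64 * (b + 1) * (n - 3 - b) := by
    nlinarith [sq_nonneg ((n:ℝ) - 4 - 2 * b)]
  have ha1 : 0 ≤ ((a : ℝ) + 1) * ((n : ℝ) - 3 - (a : ℝ)) := mul_nonneg (by linarith) (by linarith)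
  apply Real.sqrt_lt_sqrt
  · have : √((4 * (n:ℝ) + 1) ^ 2 - 64 * (a + 1) * (n - 3 - a)) ≤ 4 * n + 1 := by
      rw [Real.sqrt_le_left (by positivity)]
      linarith
    linarith
  · have := Real.sqrt_lt_sqrt hb0 (show (4 * (n:ℝ) + 1) ^ 2 - 64 * (b + 1) * (n - 3 - b) <
      (4 * (n:ℝ) + 1) ^ 2 - 64 * (a + 1) * (n - 3 - a) by linarith)
    linarith
end
end

section
/- Let T be a tree on n vertices with diameter 3. Then ξ_2(T^c) ≤ sqrt((4n+1−sqrt(72n−63))/2) if n is even, and ξ_2(T^c) ≤ sqrt((4n+1−sqrt(72n−47))/2) if n is odd; in either case equality holds if and only if T is isomorphic to T_{n,3}^{⌊(n−4)/2⌋,⌈(n−4)/2⌉}. -/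
noncomputable section

open SimpleGraph

/-- Adjacency pattern of the path `2 - 0 - 1 - 3`. -/
def patR : Fin 4 → Fin 4 → Bool :=
  ![![false, true, true, false], ![true, false, false, true],
    ![true, false, false, false], ![false, true, false, false]]

/-- Positions of labels along the complement. -/
def patG : Fin 4 → ℕ := ![0, 3, 2, 1]

/-- Distances in the complement between distinct vertices. -/
def patD : Fin 4 → Fin 4 → ℕ :=
  ![![1, 3, 2, 1], ![3, 1, 1, 2], ![2, 1, 1, 1], ![1, 2, 1, 1]]

/-- Eccentricities in the complement. -/
def patE : Fin 4 → ℕ := ![3, 3, 2, 2]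

/-- `T` is the double star with label function `f` and `p`, `q` leaves. -/
structure DS {n : ℕ} (T : SimpleGraph (Fin n)) (f : Fin n → Fin 4) (p q : ℕ) : Prop where
  adj : ∀ x y, T.Adj x y ↔ patR (f x) (f y) = true
  c0 : (Finset.univ.filter fun x => f x = 0).card = 1
  c1 : (Finset.univ.filter fun x => f x = 1).card = 1
  c2 : (Finset.univ.filter fun x => f x = 2).card = p
  c3 : (Finset.univ.filter fun x => f x = 3).card = q
  hp : 0 < p
  hq : 0 < q

theorem fin4_cases (i : Fin 4) : i = 0 ∨ i = 1 ∨ i = 2 ∨ i = 3 := by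
  revert i; decide

theorem DS.reps {n : ℕ} {T : SimpleGraph (Fin n)} {f : Fin n → Fin 4} {p q : ℕ}
    (h : DS T f p q) : ∀ i, ∃ x, f x = i := by
  intro i
  have key : 0 < (Finset.univ.filter fun x => f x = i).card := by
    have h0 := h.c0; have h1 := h.c1; have h2 := h.c2; have h3 := h.c3
    have hp := h.hp; have hq := h.hq
    rcases fin4_cases i with rfl | rfl | rfl | rfl <;> omega
  obtain ⟨x, hx⟩ := Finset.card_pos.mp key
  exact ⟨x, by simpa using hx⟩

theorem DS.card_eq {n : ℕ} {T : SimpleGraph (Fin n)} {f : Fin n → Fin 4} {p q : ℕ}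
    (h : DS T f p q) : n = p + q + 2 := by
  have key := Finset.card_eq_sum_card_fiberwise (f := f) (s := Finset.univ) (t := Finset.univ)
    (by simp)
  rw [Fin.sum_univ_four, h.c0, h.c1, h.c2, h.c3] at key
  simp at key
  omega

theorem DS.adjc {n : ℕ} {T : SimpleGraph (Fin n)} {f : Fin n → Fin 4} {p q : ℕ}
    (h : DS T f p q) (x y : Fin n) : Tᶜ.Adj x y ↔ x ≠ y ∧ patR (f x) (f y) = false := by
  rw [SimpleGraph.compl_adj, h.adj]; simp

theorem DS.lower {n : ℕ} {T : SimpleGraph (Fin n)} {f : Fin n → Fin 4} {p q : ℕ}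
    (h : DS T f p q) {x y : Fin n} (w : Tᶜ.Walk x y) :
    (f x = f y ∨ patD (f x) (f y) ≤ w.length) := by
  have key : patG (f x) ≤ patG (f y) + w.length ∧ patG (f y) ≤ patG (f x) + w.length := by
    induction w with
    | nil => simp
    | @cons u v w hadj q ih =>
      have h1 := ((h.adjc _ _).mp hadj).2
      have : ∀ i j, patR i j = false → patG i ≤ patG j + 1 ∨ (i = j) := by decide
      have h2 : ∀ i j, patR i j = false → patG i ≤ patG j + 1 ∧ patG j ≤ patG i + 1 := by decide
      have h3 := h2 _ _ h1
      rw [SimpleGraph.Walk.length_cons]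
      omega
  have h2 : ∀ i j : Fin 4, i = j ∨ patD i j + patG j = patG i ∨ patD i j + patG i = patG j := by
    decide
  rcases h2 (f x) (f y) with h | h | h
  · exact Or.inl h
  · right; omega
  · right; omega

theorem DS.upper {n : ℕ} {T : SimpleGraph (Fin n)} {f : Fin n → Fin 4} {p q : ℕ}
    (h : DS T f p q) {x y : Fin n} (hxy : x ≠ y) :
    ∃ w : Tᶜ.Walk x y, w.length = patD (f x) (f y) := by
  obtain ⟨u, hu⟩ := h.reps 2
  obtain ⟨v, hv⟩ := h.reps 3
  have st : ∀ a b, a ≠ b → patR (f a) (f b) = false → Tᶜ.Adj a b :=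
    fun a b h1 h2 => (h.adjc a b).mpr ⟨h1, h2⟩
  have ne : ∀ a b, f a ≠ f b → a ≠ b := fun a b h1 h2 => h1 (by rw [h2])
  have one : patR (f x) (f y) = false → patD (f x) (f y) = 1 →
      ∃ w : Tᶜ.Walk x y, w.length = patD (f x) (f y) := by
    intro h1 h2
    exact ⟨(st x y hxy h1).toWalk, by simp [h2]⟩
  have two : ∀ z, f x ≠ f z → f z ≠ f y → patR (f x) (f z) = false → patR (f z) (f y) = false →
      patD (f x) (f y) = 2 → ∃ w : Tᶜ.Walk x y, w.length = patD (f x) (f y) := by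
    intro z h1 h2 h3 h4 h5
    exact ⟨.cons (st x z (ne _ _ h1) h3) (st z y (ne _ _ h2) h4).toWalk, by simp [h5]⟩
  have three : ∀ z z', f x ≠ f z → f z ≠ f z' → f z' ≠ f y → patR (f x) (f z) = false →
      patR (f z) (f z') = false → patR (f z') (f y) = false →
      patD (f x) (f y) = 3 → ∃ w : Tᶜ.Walk x y, w.length = patD (f x) (f y) := by
    intro z z' h1 h1' h2 h3 h3' h4 h5
    exact ⟨.cons (st x z (ne _ _ h1) h3) (.cons (st z z' (ne _ _ h1') h3')
      (st z' y (ne _ _ h2) h4).toWalk), by simp [h5]⟩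
  have hu2 := two u
  have hv2 := two v
  have huv := three u v
  have hvu := three v u
  rw [hu] at hu2 huv hvu
  rw [hv] at hv2 huv hvu
  clear two three
  revert one hu2 hv2 huv hvu
  rcases fin4_cases (f x) with h1 | h1 | h1 | h1 <;>
  rcases fin4_cases (f y) with h2 | h2 | h2 | h2 <;> rw [h1, h2] <;>
  intro one hu2 hv2 huv hvu <;>
  first
  | exact one (by decide) (by decide)
  | exact hu2 (by decide) (by decide) (by decide) (by decide) (by decide)
  | exact hv2 (by decide) (by decide) (by decide) (by decide) (by decide)
  | exact huv (by decide) (by decide) (by decide) (by decide) (by decide) (by decide) (by decide)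
  | exact hvu (by decide) (by decide) (by decide) (by decide) (by decide) (by decide) (by decide)

theorem DS.dist {n : ℕ} {T : SimpleGraph (Fin n)} {f : Fin n → Fin 4} {p q : ℕ}
    (h : DS T f p q) {x y : Fin n} (hxy : x ≠ y) :
    Tᶜ.dist x y = patD (f x) (f y) := by
  obtain ⟨w, hw⟩ := h.upper hxy
  apply le_antisymm (hw ▸ SimpleGraph.dist_le w)
  obtain ⟨w', hw'⟩ := (SimpleGraph.Walk.reachable w).exists_walk_length_eq_dist
  have hpos := (SimpleGraph.Walk.reachable w).pos_dist_of_ne hxy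
  rcases h.lower w' with h1 | h1
  · rw [h1]
    have : ∀ i, patD i i = 1 := by decide
    rw [this]; exact hpos
  · omega

theorem DS.ecc {n : ℕ} {T : SimpleGraph (Fin n)} {f : Fin n → Fin 4} {p q : ℕ}
    (h : DS T f p q) (x : Fin n) : ecc Tᶜ x = patE (f x) := by
  apply le_antisymm
  · apply Finset.sup_le
    intro y _
    by_cases hxy : x = y
    · subst hxy; simp
    · rw [h.dist hxy]
      have : ∀ i j, patD i j ≤ patE i := by decide
      exact this _ _
  · have : ∀ i, ∃ j, i ≠ j ∧ patE i = patD i j := by decide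
    obtain ⟨j, hj, hj2⟩ := this (f x)
    obtain ⟨y, hy⟩ := h.reps j
    have hxy : x ≠ y := by rintro rfl; exact hj hy
    rw [hj2, ← hy, ← h.dist hxy]
    exact Finset.le_sup (f := fun u => Tᶜ.dist x u) (Finset.mem_univ y)

/-- The quotient weights. -/
def patW : Matrix (Fin 4) (Fin 4) ℝ :=
  !![0, 3, 2, 0; 3, 0, 0, 2; 2, 0, 0, 0; 0, 2, 0, 0]

theorem DS.mat {n : ℕ} {T : SimpleGraph (Fin n)} {f : Fin n → Fin 4} {p q : ℕ}
    (h : DS T f p q) (x y : Fin n) : eccMatrix Tᶜ x y = patW (f x) (f y) := by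
  unfold eccMatrix
  by_cases hxy : x = y
  · subst hxy
    rcases fin4_cases (f x) with h1 | h1 | h1 | h1 <;> simp [h1, patW]
  · rw [h.ecc, h.ecc, h.dist hxy]
    rcases fin4_cases (f x) with h1 | h1 | h1 | h1 <;>
    rcases fin4_cases (f y) with h2 | h2 | h2 | h2 <;>
    simp [h1, h2, patW, patD, patE, hxy]

/-- Indicator matrix of the labels. -/
def patU {n : ℕ} (f : Fin n → Fin 4) : Matrix (Fin n) (Fin 4) ℝ :=
  fun x i => if f x = i then 1 else 0

theorem DS.fact {n : ℕ} {T : SimpleGraph (Fin n)} {f : Fin n → Fin 4} {p q : ℕ}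
    (h : DS T f p q) : eccMatrix Tᶜ = patU f * (patW * (patU f).transpose) := by
  ext x y
  rw [h.mat]
  simp [Matrix.mul_apply, patU]

theorem DS.gram {n : ℕ} {T : SimpleGraph (Fin n)} {f : Fin n → Fin 4} {p q : ℕ}
    (h : DS T f p q) : (patW * (patU f).transpose) * patU f =
      !![0, 3, 2 * (p : ℝ), 0; 3, 0, 0, 2 * (q : ℝ); 2, 0, 0, 0; 0, 2, 0, 0] := by
  have : (patU f).transpose * patU f = Matrix.diagonal ![1, 1, (p : ℝ), (q : ℝ)] := by
    ext i j
    rw [Matrix.mul_apply]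
    by_cases hij : i = j
    · subst hij
      simp only [Matrix.transpose_apply, patU, mul_ite, mul_one, mul_zero]
      have : ∀ x, (if f x = i then (if f x = i then (1 : ℝ) else 0) else 0)
        = if f x = i then 1 else 0 := by intro x; split_ifs <;> rfl
      simp only [this, Finset.sum_boole, Matrix.diagonal_apply_eq]
      rcases fin4_cases i with rfl | rfl | rfl | rfl
      · simp [h.c0]
      · simp [h.c1]
      · simp [h.c2]
      · simp [h.c3]
    · rw [Matrix.diagonal_apply_ne _ hij]
      apply Finset.sum_eq_zero
      intro x _
      simp only [Matrix.transpose_apply, patU]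
      by_cases h1 : f x = i
      · have : f x ≠ j := fun h2 => hij (h1.symm.trans h2)
        simp [this]
      · simp [h1]
  rw [Matrix.mul_assoc, this]
  ext i j
  rw [Matrix.mul_diagonal]
  rcases fin4_cases i with rfl | rfl | rfl | rfl <;>
  rcases fin4_cases j with rfl | rfl | rfl | rfl <;> simp [patW]

open Polynomial in
theorem DS.charpoly {n : ℕ} {T : SimpleGraph (Fin n)} {f : Fin n → Fin 4} {p q : ℕ}
    (h : DS T f p q) : (eccMatrix Tᶜ).charpoly =
      X ^ (n - 4) * (X ^ 4 - C (9 + 4 * (p : ℝ) + 4 * q) * X ^ 2 + C (16 * (p : ℝ) * q)) := by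
  have hn := h.card_eq
  have hp := h.hp
  have hq := h.hq
  rw [h.fact, Matrix.charpoly_mul_comm_of_le _ _ (by simp; omega), h.gram]
  simp only [Fintype.card_fin]
  congr 1
  rw [Matrix.charpoly, Matrix.det_succ_row_zero]
  simp [Fin.sum_univ_four, Matrix.det_fin_three, Matrix.charmatrix, Fin.succAbove,
    Matrix.diagonal, Matrix.submatrix]
  simp only [map_ofNat]
  ring

theorem path_len {n : ℕ} {T : SimpleGraph (Fin n)} (hT : T.IsTree) {x y : Fin n}
    (w : T.Walk x y) (hw : w.IsPath) : T.dist x y = w.length := by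
  obtain ⟨p, hp, hl⟩ := hT.1.exists_path_of_dist x y
  have := (hT.2.subsingleton_path x y).elim ⟨w, hw⟩ ⟨p, hp⟩
  simp only [Subtype.mk.injEq] at this
  rw [← hl, this]

theorem path2 {n : ℕ} {T : SimpleGraph (Fin n)} (hT : T.IsTree) {x y z : Fin n}
    (h1 : T.Adj x y) (h2 : T.Adj y z) (h : x ≠ z) : T.dist x z = 2 := by
  rw [path_len hT (.cons h1 (.cons h2 .nil))]
  · rfl
  · simp [SimpleGraph.Walk.isPath_def, h1.ne, h2.ne, h]

theorem path3 {n : ℕ} {T : SimpleGraph (Fin n)} (hT : T.IsTree) {x y z t : Fin n}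
    (h1 : T.Adj x y) (h2 : T.Adj y z) (h3 : T.Adj z t) (h : x ≠ z) (h' : y ≠ t) (h'' : x ≠ t) :
    T.dist x t = 3 := by
  rw [path_len hT (.cons h1 (.cons h2 (.cons h3 .nil)))]
  · rfl
  · simp [SimpleGraph.Walk.isPath_def, h1.ne, h2.ne, h3.ne, h, h', h'']

theorem path4 {n : ℕ} {T : SimpleGraph (Fin n)} (hT : T.IsTree) {x y z t s : Fin n}
    (h1 : T.Adj x y) (h2 : T.Adj y z) (h3 : T.Adj z t) (h4 : T.Adj t s)
    (a1 : x ≠ z) (a2 : x ≠ t) (a3 : x ≠ s) (a4 : y ≠ t) (a5 : y ≠ s) (a6 : z ≠ s) :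
    T.dist x s = 4 := by
  rw [path_len hT (.cons h1 (.cons h2 (.cons h3 (.cons h4 .nil))))]
  · rfl
  · simp [SimpleGraph.Walk.isPath_def, h1.ne, h2.ne, h3.ne, h4.ne, *]

theorem no_tri {n : ℕ} {T : SimpleGraph (Fin n)} (hT : T.IsTree) {x y z : Fin n}
    (h1 : T.Adj x y) (h2 : T.Adj y z) (h3 : T.Adj x z) : False := by
  have := path2 hT h1 h2 h3.ne
  rw [SimpleGraph.dist_eq_one_iff_adj.mpr h3] at this
  omega

theorem exists_boundary {n : ℕ} {T : SimpleGraph (Fin n)} {x y : Fin n} (w : T.Walk x y)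
    (S : Fin n → Prop) (hx : S x) (hy : ¬ S y) : ∃ a b, S a ∧ ¬ S b ∧ T.Adj a b := by
  induction w with
  | nil => exact absurd hx hy
  | @cons u v w h p ih =>
    by_cases hv : S v
    · exact ih hv hy
    · exact ⟨u, v, hx, hv, h⟩

theorem exists_DS {n : ℕ} (T : SimpleGraph (Fin n)) (hT : T.IsTree) (hd : gdiam T = 3) :
    ∃ f p q, DS T f p q := by
  have hle : ∀ x y, T.dist x y ≤ 3 := by
    intro x y
    rw [← hd]
    exact Finset.le_sup (f := fun p : Fin n × Fin n => T.dist p.1 p.2) (Finset.mem_univ (x, y))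
  have hex : ∃ x y, T.dist x y = 3 := by
    by_contra hcon
    push Not at hcon
    have : gdiam T ≤ 2 := by
      apply Finset.sup_le
      rintro ⟨x, y⟩ _
      have h1 := hle x y
      have h2 := hcon x y
      show T.dist x y ≤ 2
      omega
    omega
  obtain ⟨u, v, huv⟩ := hex
  obtain ⟨w, hw, hl⟩ := hT.1.exists_path_of_dist u v
  rw [huv] at hl
  have hcd : ∃ c d, T.Adj u c ∧ T.Adj c d ∧ T.Adj d v ∧ u ≠ d ∧ c ≠ v := by
    cases w with
    | nil => simp at hl
    | cons h1 w =>
    cases w with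
    | nil => simp at hl
    | cons h2 w =>
    cases w with
    | nil => simp at hl
    | cons h3 w =>
    cases w with
    | cons h4 w => simp at hl
    | nil =>
      simp [SimpleGraph.Walk.isPath_def] at hw
      exact ⟨_, _, h1, h2, h3, by tauto, by tauto⟩
  obtain ⟨c, d, huc, hcd, hdv, hud, hcv⟩ := hcd
  have hncv : ¬ T.Adj c v := fun h => no_tri hT hcd hdv h
  have hnud : ¬ T.Adj u d := fun h => no_tri hT huc hcd h
  have huv' : u ≠ v := by rintro rfl; simp at huv
  have cover : ∀ x, x = c ∨ x = d ∨ T.Adj c x ∨ T.Adj d x := by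
    by_contra hcon
    push Not at hcon
    obtain ⟨x, hx⟩ := hcon
    obtain ⟨w⟩ := hT.1.preconnected c x
    obtain ⟨a, b, ha, hb, hab⟩ := exists_boundary w
      (fun x => x = c ∨ x = d ∨ T.Adj c x ∨ T.Adj d x) (by simp) (by simp; tauto)
    simp only [not_or] at hb
    obtain ⟨b1, b2, b3, b4⟩ := hb
    rcases ha with rfl | rfl | ha | ha
    · exact b3 hab
    · exact b4 hab
    · have := path4 hT hab.symm ha.symm hcd hdv b1 b2 (by rintro rfl; exact b4 hdv)
        (by rintro rfl; exact b4 hab) (by rintro rfl; exact hncv ha) hcv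
      have := hle b v
      omega
    · have := path4 hT hab.symm ha.symm hcd.symm huc.symm b2 b1 (by rintro rfl; exact b3 huc.symm)
        (by rintro rfl; exact b3 hab) (by rintro rfl; exact hnud ha.symm) hud.symm
      have := hle b u
      omega
  have both : ∀ x, T.Adj c x → T.Adj d x → False := fun x h1 h2 => no_tri hT hcd h2 h1
  have cross : ∀ x y, T.Adj c x → T.Adj d y → x ≠ d → y ≠ c → T.Adj x y → False := by
    intro x y h1 h2 h3 h4 h5
    have := path3 hT h1.symm hcd h2 h3 h4.symm h5.ne
    rw [SimpleGraph.dist_eq_one_iff_adj.mpr h5] at this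
    omega
  have same : ∀ a x y, T.Adj a x → T.Adj a y → T.Adj x y → False :=
    fun a x y h1 h2 h3 => no_tri hT h1 h3 h2
  classical
  let f : Fin n → Fin 4 := fun x =>
    if x = c then 0 else if x = d then 1 else if T.Adj c x then 2 else 3
  have f0 : ∀ x, f x = 0 ↔ x = c := by
    intro x; simp only [f]; split_ifs <;> simp [*]
    exact hcd.ne'
  have f1 : ∀ x, f x = 1 ↔ x = d := by
    intro x; simp only [f]; split_ifs <;> simp [*]
    exact hcd.ne
  have f2 : ∀ x, f x = 2 ↔ x ≠ d ∧ T.Adj c x := by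
    intro x; simp only [f]; split_ifs <;> simp [*]
  have f3 : ∀ x, f x = 3 ↔ x ≠ c ∧ T.Adj d x := by
    intro x
    have h1 := cover x
    have h2 := both x
    simp only [f]; split_ifs with g1 g2 g3
    · simp [g1]
    · simp [g2]
    · simp; tauto
    · simp; tauto
  refine ⟨f, _, _, ?_, ?_, ?_, rfl, rfl, ?_, ?_⟩
  · intro x y
    rcases fin4_cases (f x) with h1 | h1 | h1 | h1 <;>
    rcases fin4_cases (f y) with h2 | h2 | h2 | h2 <;> rw [h1, h2] <;>
    simp only [f0, f1, f2, f3] at h1 h2 <;> simp only [patR] <;> simp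
    · subst h1 h2; simp
    · subst h1 h2; exact hcd
    · subst h1; exact h2.2
    · subst h1; exact fun h => both _ h h2.2
    · subst h1 h2; exact hcd.symm
    · subst h1 h2; simp
    · subst h1; exact fun h => both _ h2.2 h
    · subst h1; exact h2.2
    · subst h2; exact h1.2.symm
    · subst h2; exact fun h => both _ h1.2 h.symm
    · exact fun h => same _ _ _ h1.2 h2.2 h
    · exact fun h => cross _ _ h1.2 h2.2 h1.1 h2.1 h
    · subst h2; exact fun h => both _ h.symm h1.2
    · subst h2; exact h1.2.symm
    · exact fun h => cross _ _ h2.2 h1.2 h2.1 h1.1 h.symm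
    · exact fun h => same _ _ _ h1.2 h2.2 h
  · simp [f0, Finset.filter_eq']
  · simp [f1, Finset.filter_eq']
  · exact Finset.card_pos.mpr ⟨u, by simp [f2]; exact ⟨hud, huc.symm⟩⟩
  · exact Finset.card_pos.mpr ⟨v, by simp [f3]; exact ⟨hcv.symm, hdv⟩⟩

theorem DS.swap {n : ℕ} {T : SimpleGraph (Fin n)} {f : Fin n → Fin 4} {p q : ℕ}
    (h : DS T f p q) : DS T (fun x => ![1, 0, 3, 2] (f x)) q p := by
  have e : ∀ i j : Fin 4, (![1, 0, 3, 2] i : Fin 4) = j ↔ i = ![1, 0, 3, 2] j := by decide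
  have r : ∀ i j : Fin 4, patR (![1, 0, 3, 2] i) (![1, 0, 3, 2] j) = patR i j := by decide
  refine ⟨?_, ?_, ?_, ?_, ?_, h.hq, h.hp⟩
  · intro x y; rw [r]; exact h.adj x y
  all_goals simp only [e]
  · exact h.c1
  · exact h.c0
  · exact h.c3
  · exact h.c2

theorem DS.iso {n : ℕ} {T T' : SimpleGraph (Fin n)} {f f' : Fin n → Fin 4} {p q : ℕ}
    (h : DS T f p q) (h' : DS T' f' p q) : Nonempty (T ≃g T') := by
  have hc : ∀ i, Nonempty ({x // f x = i} ≃ {x // f' x = i}) := by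
    intro i
    refine ⟨Fintype.equivOfCardEq ?_⟩
    rw [Fintype.card_subtype, Fintype.card_subtype]
    rcases fin4_cases i with rfl | rfl | rfl | rfl
    · rw [h.c0, h'.c0]
    · rw [h.c1, h'.c1]
    · rw [h.c2, h'.c2]
    · rw [h.c3, h'.c3]
  let e : Fin n ≃ Fin n := (Equiv.sigmaFiberEquiv f).symm.trans
    ((Equiv.sigmaCongrRight fun i => (hc i).some).trans (Equiv.sigmaFiberEquiv f'))
  have he : ∀ x, f' (e x) = f x := fun x => ((hc (f x)).some ⟨x, rfl⟩).2
  refine ⟨⟨e, ?_⟩⟩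
  intro x y
  rw [h'.adj, h.adj, he, he]

theorem DS.transfer {n : ℕ} {T T' : SimpleGraph (Fin n)} {f' : Fin n → Fin 4} {p q : ℕ}
    (e : T ≃g T') (h' : DS T' f' p q) : DS T (fun x => f' (e x)) p q := by
  have hc : ∀ i, (Finset.univ.filter fun x => f' (e x) = i).card =
      (Finset.univ.filter fun x => f' x = i).card := by
    intro i
    apply Finset.card_bij (fun x _ => e x)
    · intro x hx; simpa using hx
    · intro x _ y _ hxy; exact e.injective hxy
    · intro y hy; exact ⟨e.symm y, by simpa using hy, by simp⟩
  refine ⟨?_, ?_, ?_, ?_, ?_, h'.hp, h'.hq⟩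
  · intro x y; rw [← h'.adj]; exact e.map_adj_iff.symm
  · rw [hc]; exact h'.c0
  · rw [hc]; exact h'.c1
  · rw [hc]; exact h'.c2
  · rw [hc]; exact h'.c3

theorem Tnd_DS (n a : ℕ) (ha : a + 4 ≤ n) :
    ∃ f, DS (Tnd n 3 a) f (a + 1) (n - (a + 3)) := by
  let f : Fin n → Fin 4 := fun x =>
    if x.val = 1 then 0 else if x.val = 2 then 1 else
      if x.val = 0 ∨ (3 < x.val ∧ x.val ≤ 3 + a) then 2 else 3
  have f0 : ∀ x, f x = 0 ↔ x.val = 1 := by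
    intro x; simp only [f]; split_ifs <;> simp [*]
  have f1 : ∀ x, f x = 1 ↔ x.val = 2 := by
    intro x; simp only [f]; split_ifs <;> simp [*]
  have f2 : ∀ x, f x = 2 ↔ x.val = 0 ∨ (3 < x.val ∧ x.val ≤ 3 + a) := by
    intro x; simp only [f]; split_ifs <;> simp [*]
  have f3 : ∀ x, f x = 3 ↔ x.val = 3 ∨ 3 + a < x.val := by
    intro x; simp only [f]; split_ifs <;> simp <;> omega
  have c0 : (Finset.univ.filter fun x => f x = 0).card = 1 := by
    rw [Finset.card_eq_one]
    refine ⟨⟨1, by omega⟩, ?_⟩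
    ext x; simp [f0, Fin.ext_iff]
  have c1 : (Finset.univ.filter fun x => f x = 1).card = 1 := by
    rw [Finset.card_eq_one]
    refine ⟨⟨2, by omega⟩, ?_⟩
    ext x; simp [f1, Fin.ext_iff]
  have c2 : (Finset.univ.filter fun x => f x = 2).card = a + 1 := by
    have : (Finset.univ.filter fun x => f x = 2).map Fin.valEmbedding
        = insert 0 (Finset.Ioc 3 (3 + a)) := by
      ext k
      simp only [Finset.mem_map, Finset.mem_filter, Finset.mem_univ, true_and, f2,
        Fin.valEmbedding_apply, Finset.mem_insert, Finset.mem_Ioc]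
      constructor
      · rintro ⟨x, hx, rfl⟩; exact hx
      · intro hk; exact ⟨⟨k, by omega⟩, hk, rfl⟩
    rw [← Finset.card_map Fin.valEmbedding, this, Finset.card_insert_of_notMem (by simp)]
    simp
  have c3 : (Finset.univ.filter fun x => f x = 3).card = n - (a + 3) := by
    have key := Finset.card_eq_sum_card_fiberwise (f := f) (s := Finset.univ) (t := Finset.univ)
      (by simp)
    rw [Fin.sum_univ_four, c0, c1, c2] at key
    simp only [Finset.card_univ, Fintype.card_fin] at key
    omega
  refine ⟨f, ?_, c0, c1, c2, c3, by omega, by omega⟩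
  intro x y
  unfold Tnd
  rw [SimpleGraph.fromRel_adj, ne_eq, Fin.ext_iff]
  rcases fin4_cases (f x) with h1 | h1 | h1 | h1 <;>
  rcases fin4_cases (f y) with h2 | h2 | h2 | h2 <;> rw [h1, h2] <;>
  simp only [f0, f1, f2, f3] at h1 h2 <;> simp only [patR] <;> simp <;> omega

/-- The second largest eigenvalue. -/
def xiVal (p q : ℕ) : ℝ :=
  Real.sqrt ((9 + 4 * (p : ℝ) + 4 * q -
    Real.sqrt ((9 + 4 * (p : ℝ) + 4 * q) ^ 2 - 64 * (p : ℝ) * q)) / 2)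

theorem xiVal_comm (p q : ℕ) : xiVal p q = xiVal q p := by
  unfold xiVal
  congr 3
  · ring
  · congr 1; ring

theorem disc_pos (p q : ℕ) : 0 < (9 + 4 * (p : ℝ) + 4 * q) ^ 2 - 64 * (p : ℝ) * q := by
  have hp : (0 : ℝ) ≤ p := Nat.cast_nonneg p
  have hq : (0 : ℝ) ≤ q := Nat.cast_nonneg q
  nlinarith [sq_nonneg ((p : ℝ) - q)]

theorem disc_le (p q : ℕ) : Real.sqrt ((9 + 4 * (p : ℝ) + 4 * q) ^ 2 - 64 * (p : ℝ) * q) ≤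
    9 + 4 * (p : ℝ) + 4 * q := by
  apply Real.sqrt_le_iff.mpr
  refine ⟨by positivity, ?_⟩
  have : (0 : ℝ) ≤ 64 * (p : ℝ) * q := by positivity
  linarith

theorem xiVal_lt (p q p' q' : ℕ) (hs : p' + q' = p + q) (h : p * q < p' * q') :
    xiVal p q < xiVal p' q' := by
  have hs' : (p' : ℝ) + q' = p + q := by exact_mod_cast hs
  have h' : (p : ℝ) * q < p' * q' := by exact_mod_cast h
  unfold xiVal
  have e : 9 + 4 * (p' : ℝ) + 4 * q' = 9 + 4 * (p : ℝ) + 4 * q := by linarith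
  have h1 := disc_le p q
  have h2 := disc_pos p' q'
  rw [e] at h2 ⊢
  apply Real.sqrt_lt_sqrt
  · linarith
  · have := Real.sqrt_lt_sqrt h2.le (y := (9 + 4 * (p : ℝ) + 4 * q) ^ 2 - 64 * (p : ℝ) * q)
      (by nlinarith)
    linarith

open Polynomial in
theorem DS.xi_two {n : ℕ} {T : SimpleGraph (Fin n)} {f : Fin n → Fin 4} {p q : ℕ}
    (h : DS T f p q) : xi Tᶜ 2 = xiVal p q := by
  set S : ℝ := 9 + 4 * (p : ℝ) + 4 * q with hS
  set r : ℝ := Real.sqrt (S ^ 2 - 64 * (p : ℝ) * q) with hr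
  have hr0 : 0 ≤ r := Real.sqrt_nonneg _
  have hrS : r ≤ S := disc_le p q
  have hr2 : r ^ 2 = S ^ 2 - 64 * (p : ℝ) * q := Real.sq_sqrt (disc_pos p q).le
  set α : ℝ := Real.sqrt ((S + r) / 2) with hα
  have hβ : xiVal p q = Real.sqrt ((S - r) / 2) := rfl
  rw [hβ]
  set β : ℝ := Real.sqrt ((S - r) / 2)
  have hα2 : α ^ 2 = (S + r) / 2 := Real.sq_sqrt (by linarith)
  have hβ2 : β ^ 2 = (S - r) / 2 := Real.sq_sqrt (by linarith)
  have hβ0 : 0 ≤ β := Real.sqrt_nonneg _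
  have hβα : β ≤ α := Real.sqrt_le_sqrt (by linarith)
  have e1 : S = α ^ 2 + β ^ 2 := by linarith
  have e2 : 16 * (p : ℝ) * q = α ^ 2 * β ^ 2 := by rw [hα2, hβ2]; linarith
  have hroots : eccEigs Tᶜ = (([-α, -β] ++ List.replicate (n - 4) 0 ++ [β, α] : List ℝ) :
      Multiset ℝ) := by
    have hc : (eccMatrix Tᶜ).charpoly =
        (Multiset.map (fun a => X - C a)
          (([-α, -β] ++ List.replicate (n - 4) 0 ++ [β, α] : List ℝ) : Multiset ℝ)).prod := by
      rw [h.charpoly, ← hS, e1, e2]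
      simp
      ring
    unfold eccEigs
    rw [hc, roots_multiset_prod_X_sub_C]
  have hsort : (eccEigs Tᶜ).sort (· ≤ ·) = [-α, -β] ++ List.replicate (n - 4) 0 ++ [β, α] := by
    apply List.Perm.eq_of_pairwise' (r := (· ≤ ·))
    · exact Multiset.pairwise_sort _ _
    · simp [List.pairwise_append, List.pairwise_replicate]
      grind
    · rw [← Multiset.coe_eq_coe, Multiset.sort_eq, hroots]
  unfold xi eccEigList
  rw [hsort]
  simp

/-- Corollary 4.3: maximum second largest `𝓔`-eigenvalue among complements of
trees of diameter `3`. -/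
theorem stmt_9 {n : ℕ} (T : SimpleGraph (Fin n)) (hT : T.IsTree) (hd : gdiam T = 3) (B : ℝ)
    (hB : B = if Even n then Real.sqrt ((4 * (n : ℝ) + 1 - Real.sqrt (72 * (n : ℝ) - 63)) / 2)
      else Real.sqrt ((4 * (n : ℝ) + 1 - Real.sqrt (72 * (n : ℝ) - 47)) / 2)) :
    xi Tᶜ 2 ≤ B ∧ (xi Tᶜ 2 = B ↔ Nonempty (T ≃g Tnd n 3 ((n - 4) / 2))) := by
  obtain ⟨f, p, q, h⟩ := exists_DS T hT hd
  have hn := h.card_eq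
  have hp := h.hp
  have hq := h.hq
  have hn4 : 4 ≤ n := by omega
  obtain ⟨g, hg⟩ := Tnd_DS n ((n - 4) / 2) (by omega)
  set p₀ := (n - 4) / 2 + 1 with hp₀
  set q₀ := n - ((n - 4) / 2 + 3) with hq₀
  have hsum : p₀ + q₀ = p + q := by omega
  have hval : B = xiVal p₀ q₀ := by
    rw [hB]
    unfold xiVal
    rcases Nat.even_or_odd n with he | ho
    · rw [if_pos he]
      obtain ⟨k, hk⟩ := he
      have h1 : p₀ = q₀ := by omega
      have h2 : n = 2 * q₀ + 2 := by omega
      rw [h1, h2]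
      push_cast
      congr 3
      · ring
      · congr 1; ring
    · rw [if_neg (by simpa using ho)]
      obtain ⟨k, hk⟩ := ho
      have h1 : q₀ = p₀ + 1 := by omega
      have h2 : n = 2 * p₀ + 3 := by omega
      rw [h1, h2]
      push_cast
      congr 3
      · ring
      · congr 1; ring
  rw [h.xi_two, hval]
  have hcase : (p = p₀ ∧ q = q₀) ∨ (p = q₀ ∧ q = p₀) ∨ p * q < p₀ * q₀ := by
    have hd1 : q₀ = p₀ ∨ q₀ = p₀ + 1 := by omega
    by_contra hcon
    push Not at hcon
    obtain ⟨g1, g2, g3⟩ := hcon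
    have hpl : p < p₀ ∨ q < p₀ := by omega
    rcases hpl with hpl | hpl
    · obtain ⟨k, hk⟩ : ∃ k, p₀ = p + (k + 1) := ⟨p₀ - p - 1, by omega⟩
      have : q = q₀ + (k + 1) := by omega
      rw [this, hk] at g3
      have : p + (k + 1) ≤ q₀ := by omega
      nlinarith
    · obtain ⟨k, hk⟩ : ∃ k, p₀ = q + (k + 1) := ⟨p₀ - q - 1, by omega⟩
      have : p = q₀ + (k + 1) := by omega
      rw [this, hk] at g3
      have : q + (k + 1) ≤ q₀ := by omega
      nlinarith
  have hiso : Nonempty (T ≃g Tnd n 3 ((n - 4) / 2)) → xiVal p q = xiVal p₀ q₀ := by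
    rintro ⟨e⟩
    rw [← h.xi_two, (hg.transfer e).xi_two]
  rcases hcase with ⟨rfl, rfl⟩ | ⟨h1, h2⟩ | hlt
  · exact ⟨le_refl _, fun _ => h.iso hg, fun _ => rfl⟩
  · have hs := h.swap
    rw [h1, h2] at hs
    have : xiVal p q = xiVal p₀ q₀ := by rw [h1, h2, xiVal_comm]
    exact ⟨this.le, fun _ => hs.iso hg, fun _ => this⟩
  · have := xiVal_lt p q p₀ q₀ hsum hlt
    exact ⟨this.le, fun h => absurd h this.ne, fun h => absurd (hiso h) this.ne⟩
end
end

section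
/- Let n ≥ 4. For integers a with 0 ≤ a ≤ ⌊(n−4)/2⌋ set b = n − 4 − a. Then the 𝓔-energy E_𝓔((T_{n,3}^{a,b})^c) = 2·sqrt(4n+1+8·sqrt((a+1)(b+1))) is strictly increasing in a; that is, E_𝓔((T_{n,3}^{0,n−4})^c) < E_𝓔((T_{n,3}^{1,n−5})^c) < … < E_𝓔((T_{n,3}^{⌊(n−4)/2⌋,⌈(n−4)/2⌉})^c). -/
noncomputable section

open SimpleGraph

lemma x_adj {n : ℕ} (a : ℕ) (u v : Fin n) : ((Tnd n 3 a)ᶜ).Adj u v ↔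
    (u.val ≠ v.val ∧ ¬ ((u.val = 1 ∧ (v.val = 0 ∨ (3 < v.val ∧ v.val ≤ 3 + a))) ∨
      (v.val = 1 ∧ (u.val = 0 ∨ (3 < u.val ∧ u.val ≤ 3 + a))) ∨
      (u.val = 2 ∧ (v.val = 3 ∨ (3 + a < v.val))) ∨
      (v.val = 2 ∧ (u.val = 3 ∨ (3 + a < u.val))) ∨
      (u.val = 1 ∧ v.val = 2) ∨ (u.val = 2 ∧ v.val = 1))) := by
  rw [SimpleGraph.compl_adj, Tnd, SimpleGraph.fromRel_adj, Ne, Fin.ext_iff]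
  omega

lemma x_dist2 {V : Type*} (G : SimpleGraph V) (u v w : V) (h : u ≠ v) (h1 : ¬ G.Adj u v)
    (h2 : G.Adj u w) (h3 : G.Adj w v) : G.dist u v = 2 := by
  have hw : G.Reachable u v := h2.reachable.trans h3.reachable
  have hle : G.dist u v ≤ 2 := by
    simpa using SimpleGraph.dist_le (SimpleGraph.Walk.cons h2 (SimpleGraph.Walk.cons h3 SimpleGraph.Walk.nil))
  have h0 : G.dist u v ≠ 0 := by
    rw [Ne, hw.dist_eq_zero_iff]; exact h
  have h1' : G.dist u v ≠ 1 := by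
    rw [Ne, SimpleGraph.dist_eq_one_iff_adj]; exact h1
  omega

lemma x_dist3 {V : Type*} (G : SimpleGraph V) (u v w z : V) (h : u ≠ v) (h1 : ¬ G.Adj u v)
    (h2 : G.Adj u w) (h3 : G.Adj w z) (h4 : G.Adj z v)
    (h5 : ∀ y, G.Adj u y → ¬ G.Adj y v) : G.dist u v = 3 := by
  have hw : G.Reachable u v := h2.reachable.trans (h3.reachable.trans h4.reachable)
  have hle : G.dist u v ≤ 3 := by
    simpa using SimpleGraph.dist_le (SimpleGraph.Walk.cons h2 (SimpleGraph.Walk.cons h3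
      (SimpleGraph.Walk.cons h4 SimpleGraph.Walk.nil)))
  have h0 : G.dist u v ≠ 0 := by
    rw [Ne, hw.dist_eq_zero_iff]; exact h
  have h1' : G.dist u v ≠ 1 := by
    rw [Ne, SimpleGraph.dist_eq_one_iff_adj]; exact h1
  have h2' : G.dist u v ≠ 2 := by
    intro hd
    obtain ⟨p, hp⟩ := hw.exists_walk_length_eq_dist
    rw [hd] at hp
    cases p with
    | nil => simp at hp
    | cons e p =>
      cases p with
      | nil => simp at hp
      | cons e' p =>
        cases p with
        | nil => exact h5 _ e e'
        | cons e'' p => simp at hp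
  omega

lemma x_dist {n : ℕ} (hn : 4 ≤ n) (a : ℕ) (u v : Fin n) : ((Tnd n 3 a)ᶜ).dist u v =
    if u.val = v.val then 0 else
    if (u.val = 1 ∧ v.val = 2) ∨ (u.val = 2 ∧ v.val = 1) then 3 else
    if ((u.val = 1 ∧ (v.val = 0 ∨ (3 < v.val ∧ v.val ≤ 3 + a))) ∨
      (v.val = 1 ∧ (u.val = 0 ∨ (3 < u.val ∧ u.val ≤ 3 + a))) ∨
      (u.val = 2 ∧ (v.val = 3 ∨ (3 + a < v.val))) ∨
      (v.val = 2 ∧ (u.val = 3 ∨ (3 + a < u.val)))) then 2 else 1 := by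
  split_ifs with h1 h2 h3
  · rw [Fin.ext h1]; simp
  · rcases h2 with h2 | h2
    · refine x_dist3 _ u v ⟨3, by omega⟩ ⟨0, by omega⟩ (by rw [Ne, Fin.ext_iff]; exact h1) ?_ ?_ ?_ ?_ ?_
      rotate_left 4
      · intro y; simp only [x_adj]; omega
      all_goals (simp only [x_adj]; omega)
    · refine x_dist3 _ u v ⟨0, by omega⟩ ⟨3, by omega⟩ (by rw [Ne, Fin.ext_iff]; exact h1) ?_ ?_ ?_ ?_ ?_
      rotate_left 4
      · intro y; simp only [x_adj]; omega
      all_goals (simp only [x_adj]; omega)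
  · by_cases h4 : u.val = 1 ∨ v.val = 1
    · refine x_dist2 _ u v ⟨3, by omega⟩ (by rw [Ne, Fin.ext_iff]; exact h1) ?_ ?_ ?_
      all_goals (simp only [x_adj]; omega)
    · refine x_dist2 _ u v ⟨0, by omega⟩ (by rw [Ne, Fin.ext_iff]; exact h1) ?_ ?_ ?_
      all_goals (simp only [x_adj]; omega)
  · rw [SimpleGraph.dist_eq_one_iff_adj, x_adj]; omega

lemma x_ecc {n : ℕ} (hn : 4 ≤ n) (a : ℕ) (u : Fin n) : ecc ((Tnd n 3 a)ᶜ) u =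
    if u.val = 1 ∨ u.val = 2 then 3 else 2 := by
  have key : ∀ w : Fin n, ((Tnd n 3 a)ᶜ).dist u w ≤ ecc ((Tnd n 3 a)ᶜ) u := fun w =>
    Finset.le_sup (f := fun w => ((Tnd n 3 a)ᶜ).dist u w) (Finset.mem_univ w)
  apply le_antisymm
  · refine Finset.sup_le fun w _ => ?_
    rw [x_dist hn]
    split_ifs <;> omega
  · obtain ⟨w1, hw1⟩ : ∃ w : Fin n, w.val = 1 := ⟨⟨1, by omega⟩, rfl⟩
    obtain ⟨w2, hw2⟩ : ∃ w : Fin n, w.val = 2 := ⟨⟨2, by omega⟩, rfl⟩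
    have k1 := key w1
    have k2 := key w2
    rw [x_dist hn] at k1 k2
    split_ifs at k1 k2 ⊢ <;> omega

def cA (n a : ℕ) (u : Fin n) : ℝ := if u.val = 0 ∨ (3 < u.val ∧ u.val ≤ 3 + a) then 1 else 0
def cB (n a : ℕ) (u : Fin n) : ℝ := if u.val = 3 ∨ 3 + a < u.val then 1 else 0
def c1 (n : ℕ) (u : Fin n) : ℝ := if u.val = 1 then 1 else 0
def c2 (n : ℕ) (u : Fin n) : ℝ := if u.val = 2 then 1 else 0

def mU (n a : ℕ) : Matrix (Fin n) (Fin 4) ℝ := fun u => ![c1 n u, cA n a u, c2 n u, cB n a u]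
def mV (n a : ℕ) : Matrix (Fin 4) (Fin n) ℝ :=
  ![fun u => 2 * cA n a u + 3 * c2 n u, fun u => 2 * c1 n u,
    fun u => 2 * cB n a u + 3 * c1 n u, fun u => 2 * c2 n u]

lemma x_fac {n : ℕ} (hn : 4 ≤ n) (a : ℕ) : eccMatrix ((Tnd n 3 a)ᶜ) = mU n a * mV n a := by
  ext u v
  have h : (mU n a * mV n a) u v = c1 n u * (2 * cA n a v + 3 * c2 n v) + cA n a u * (2 * c1 n v)
      + c2 n u * (2 * cB n a v + 3 * c1 n v) + cB n a u * (2 * c2 n v) := by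
    rw [Matrix.mul_apply, Fin.sum_univ_four]
    rfl
  have cl : ∀ x : ℕ, ((x = 0 ∨ (3 < x ∧ x ≤ 3 + a)) ∧ ¬ (x = 3 ∨ 3 + a < x) ∧ x ≠ 1 ∧ x ≠ 2) ∨
      (¬ (x = 0 ∨ (3 < x ∧ x ≤ 3 + a)) ∧ (x = 3 ∨ 3 + a < x) ∧ x ≠ 1 ∧ x ≠ 2) ∨
      x = 1 ∨ x = 2 := by intro x; omega
  rw [h]
  simp only [eccMatrix, x_dist hn, x_ecc hn, ne_eq, Fin.ext_iff, c1, c2, cA, cB]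
  generalize u.val = x
  generalize v.val = y
  clear h
  by_cases hxy : x = y
  · subst hxy
    rcases cl x with ⟨h1, h2, h3, h4⟩ | ⟨h1, h2, h3, h4⟩ | h | h
    · simp [h1, h2, h3, h4]
    · simp [h1, h2, h3, h4]
    · simp [h]
    · simp [h, show ¬ (3 + a ≤ 1) by omega]
  · rcases cl x with ⟨h1, h2, h3, h4⟩ | ⟨h1, h2, h3, h4⟩ | h | h <;>
    rcases cl y with ⟨g1, g2, g3, g4⟩ | ⟨g1, g2, g3, g4⟩ | g | g
    · simp [h1, h2, h3, h4, g1, g2, g3, g4, hxy]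
    · simp [h1, h2, h3, h4, g1, g2, g3, g4, hxy]
    · simp [h1, h2, h3, h4, g, hxy]
    · simp [h1, h2, h3, h4, g, hxy]
    · simp [h1, h2, h3, h4, g1, g2, g3, g4, hxy]
    · simp [h1, h2, h3, h4, g1, g2, g3, g4, hxy]
    · simp [h1, h2, h3, h4, g, hxy]
    · simp [h1, h2, h3, h4, g, hxy]
    · simp [h, g1, g2, g3, g4, Ne.symm g3]
    · simp [h, g1, g2, g3, g4, Ne.symm g3]
    · simp [h, g]
    · simp [h, g]
    · simp [h, g1, g2, g3, g4, Ne.symm g4]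
    · simp [h, g1, g2, g3, g4, Ne.symm g4]
    · simp [h, g]
    · omega

lemma x_VU {n : ℕ} (hn : 4 ≤ n) (a : ℕ) (ha : a ≤ (n - 4) / 2) : mV n a * mU n a =
    !![0, 2 * ((a : ℝ) + 1), 3, 0; 2, 0, 0, 0; 3, 0, 0, 2 * ((n : ℝ) - 3 - a); 0, 0, 2, 0] := by
  have s11 : ∑ u, c1 n u * c1 n u = 1 := by
    rw [Finset.sum_eq_single ⟨1, by omega⟩]
    · simp [c1]
    · intro b _ hb
      have : b.val ≠ 1 := fun h => hb (Fin.ext h)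
      simp [c1, this]
    · simp
  have s22 : ∑ u, c2 n u * c2 n u = 1 := by
    rw [Finset.sum_eq_single ⟨2, by omega⟩]
    · simp [c2]
    · intro b _ hb
      have : b.val ≠ 2 := fun h => hb (Fin.ext h)
      simp [c2, this]
    · simp
  have z12 : ∀ u, c1 n u * c2 n u = 0 := by
    intro u; simp only [c1, c2]; split_ifs <;> first | omega | simp
  have z1A : ∀ u, c1 n u * cA n a u = 0 := by
    intro u; simp only [c1, cA]; split_ifs <;> first | omega | simp
  have z1B : ∀ u, c1 n u * cB n a u = 0 := by
    intro u; simp only [c1, cB]; split_ifs <;> first | omega | simp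
  have z2A : ∀ u, c2 n u * cA n a u = 0 := by
    intro u; simp only [c2, cA]; split_ifs <;> first | omega | simp
  have z2B : ∀ u, c2 n u * cB n a u = 0 := by
    intro u; simp only [c2, cB]; split_ifs <;> first | omega | simp
  have zAB : ∀ u, cA n a u * cB n a u = 0 := by
    intro u; simp only [cA, cB]; split_ifs <;> first | omega | simp
  have sAA : ∑ u, cA n a u * cA n a u = a + 1 := by
    have h : ∀ u : Fin n, cA n a u * cA n a u =
        (fun k : ℕ => if k = 0 ∨ (3 < k ∧ k ≤ 3 + a) then (1 : ℝ) else 0) u.val := by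
      intro u; simp only [cA]; split_ifs <;> simp
    rw [Finset.sum_congr rfl fun u _ => h u, Fin.sum_univ_eq_sum_range (fun k : ℕ =>
      if k = 0 ∨ (3 < k ∧ k ≤ 3 + a) then (1 : ℝ) else 0), Finset.sum_boole]
    have : (Finset.range n).filter (fun k => k = 0 ∨ (3 < k ∧ k ≤ 3 + a)) =
        insert 0 (Finset.Ioc 3 (3 + a)) := by
      ext k; simp only [Finset.mem_filter, Finset.mem_range, Finset.mem_insert, Finset.mem_Ioc]
      omega
    rw [this, Finset.card_insert_of_notMem (by simp)]
    simp
  have sBB : ∑ u, cB n a u * cB n a u = n - 3 - a := by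
    have h : ∀ u : Fin n, cB n a u * cB n a u =
        (fun k : ℕ => if k = 3 ∨ 3 + a < k then (1 : ℝ) else 0) u.val := by
      intro u; simp only [cB]; split_ifs <;> simp
    rw [Finset.sum_congr rfl fun u _ => h u, Fin.sum_univ_eq_sum_range (fun k : ℕ =>
      if k = 3 ∨ 3 + a < k then (1 : ℝ) else 0), Finset.sum_boole]
    have : (Finset.range n).filter (fun k => k = 3 ∨ 3 + a < k) =
        insert 3 (Finset.Ico (4 + a) n) := by
      ext k; simp only [Finset.mem_filter, Finset.mem_range, Finset.mem_insert, Finset.mem_Ico]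
      omega
    rw [this, Finset.card_insert_of_notMem (by simp; omega), Nat.card_Ico]
    have h4 : 4 + a ≤ n := by omega
    push_cast [Nat.cast_sub h4]
    ring
  have z21 : ∀ u, c2 n u * c1 n u = 0 := fun u => by rw [mul_comm, z12]
  have zA1 : ∀ u, cA n a u * c1 n u = 0 := fun u => by rw [mul_comm, z1A]
  have zB1 : ∀ u, cB n a u * c1 n u = 0 := fun u => by rw [mul_comm, z1B]
  have zA2 : ∀ u, cA n a u * c2 n u = 0 := fun u => by rw [mul_comm, z2A]
  have zB2 : ∀ u, cB n a u * c2 n u = 0 := fun u => by rw [mul_comm, z2B]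
  have zBA : ∀ u, cB n a u * cA n a u = 0 := fun u => by rw [mul_comm, zAB]
  ext i j
  rw [Matrix.mul_apply]
  fin_cases i <;> fin_cases j <;>
    simp [mU, mV, add_mul, mul_assoc, Finset.sum_add_distrib, ← Finset.mul_sum, s11, s22, sAA, sBB,
      z12, z1A, z1B, z2A, z2B, zAB, z21, zA1, zB1, zA2, zB2, zBA]

lemma x_char (p q : ℝ) :
    (!![0, 2 * p, 3, 0; 2, 0, 0, 0; 3, 0, 0, 2 * q; 0, 0, 2, 0] : Matrix (Fin 4) (Fin 4) ℝ).charpoly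
      = Polynomial.X ^ 4 - Polynomial.C (4 * (p + q) + 9) * Polynomial.X ^ 2
        + Polynomial.C (16 * (p * q)) := by
  rw [Matrix.charpoly, Matrix.det_succ_row_zero]
  simp [Fin.sum_univ_succ, Matrix.det_fin_three, Matrix.charmatrix_apply, Fin.succAbove,
    Matrix.diagonal]
  have e2 : (Polynomial.C 2 : Polynomial ℝ) = 2 := rfl
  have e3 : (Polynomial.C 3 : Polynomial ℝ) = 3 := rfl
  have e4 : (Polynomial.C 4 : Polynomial ℝ) = 4 := rfl
  have e9 : (Polynomial.C 9 : Polynomial ℝ) = 9 := rfl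
  have e16 : (Polynomial.C 16 : Polynomial ℝ) = 16 := rfl
  rw [e2, e3, e4, e9, e16]
  ring

open Polynomial in
lemma x_energy {n : ℕ} (hn : 4 ≤ n) (a : ℕ) (ha : a ≤ (n - 4) / 2) :
    eccEnergy ((Tnd n 3 a)ᶜ) =
        2 * Real.sqrt (4 * (n : ℝ) + 1 +
          8 * Real.sqrt (((a : ℝ) + 1) * ((n : ℝ) - 3 - (a : ℝ)))) := by
  obtain ⟨p, hp⟩ : ∃ p : ℝ, p = a + 1 := ⟨_, rfl⟩
  obtain ⟨q, hq⟩ : ∃ q : ℝ, q = n - 3 - a := ⟨_, rfl⟩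
  have hp0 : 0 ≤ p := by rw [hp]; positivity
  have hq0 : 0 ≤ q := by
    have : a + 3 ≤ n := by omega
    have : (a : ℝ) + 3 ≤ n := by exact_mod_cast this
    linarith
  have hn' : 4 * (n : ℝ) + 1 = 4 * (p + q) + 9 := by rw [hp, hq]; ring
  have hc : (eccMatrix ((Tnd n 3 a)ᶜ)).charpoly = X ^ (n - 4) *
      (X ^ 4 - C (4 * (p + q) + 9) * X ^ 2 + C (16 * (p * q))) := by
    rw [x_fac hn, ← x_char, hp, hq, ← x_VU hn a ha]
    have := Matrix.charpoly_mul_comm_of_le (mU n a) (mV n a) (by simpa using hn)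
    simpa using this
  rw [← hp, ← hq, hn']
  obtain ⟨r, hr⟩ : ∃ r : ℝ, r = Real.sqrt (p * q) := ⟨_, rfl⟩
  have hr2 : r ^ 2 = p * q := by rw [hr]; exact Real.sq_sqrt (mul_nonneg hp0 hq0)
  have hr0 : 0 ≤ r := by rw [hr]; positivity
  have hle : 2 * r ≤ p + q := by
    refine le_of_abs_le (abs_le_of_sq_le_sq ?_ (by positivity))
    nlinarith [sq_nonneg (p - q)]
  rw [← hr]
  obtain ⟨S, hS⟩ : ∃ S : ℝ, S = Real.sqrt (4 * (p + q) + 9 + 8 * r) := ⟨_, rfl⟩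
  obtain ⟨D, hD⟩ : ∃ D : ℝ, D = Real.sqrt (4 * (p + q) + 9 - 8 * r) := ⟨_, rfl⟩
  have hS2 : S ^ 2 = 4 * (p + q) + 9 + 8 * r := by rw [hS]; exact Real.sq_sqrt (by linarith)
  have hD2 : D ^ 2 = 4 * (p + q) + 9 - 8 * r := by rw [hD]; exact Real.sq_sqrt (by linarith)
  have hD0 : 0 ≤ D := by rw [hD]; positivity
  have hDS : D ≤ S := by rw [hD, hS]; exact Real.sqrt_le_sqrt (by linarith)
  rw [← hS]
  obtain ⟨s, hs⟩ : ∃ s : ℝ, s = (S + D) / 2 := ⟨_, rfl⟩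
  obtain ⟨t, ht⟩ : ∃ t : ℝ, t = (S - D) / 2 := ⟨_, rfl⟩
  have e1 : 4 * (p + q) + 9 = s ^ 2 + t ^ 2 := by
    rw [hs, ht]; linear_combination (-1/2) * hS2 - (1/2) * hD2
  have e2' : s * t = 4 * r := by rw [hs, ht]; linear_combination (1/4) * hS2 - (1/4) * hD2
  have e2 : 16 * (p * q) = s ^ 2 * t ^ 2 := by
    rw [← mul_pow, e2', ← hr2]; ring
  have hm : (eccMatrix ((Tnd n 3 a)ᶜ)).charpoly =
      ((Multiset.replicate (n - 4) (0 : ℝ) + {s, -s, t, -t}).map fun x => X - C x).prod := by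
    rw [hc, e1, e2]
    simp
    ring
  have hs0 : 0 ≤ s := by rw [hs]; linarith
  have ht0 : 0 ≤ t := by rw [ht]; linarith
  rw [eccEnergy, eccEigs, hm, roots_multiset_prod_X_sub_C]
  simp [abs_of_nonneg hs0, abs_of_nonneg ht0]
  rw [hs, ht]; ring

/-- Theorem 5.1: the `𝓔`-energy of `(T_{n,3}^{a,n-4-a})ᶜ` equals the stated
formula and is strictly increasing in `a` for `0 ≤ a ≤ ⌊(n-4)/2⌋`. -/
theorem stmt_13 {n : ℕ} (hn : 4 ≤ n) :
    (∀ a ≤ (n - 4) / 2,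
      eccEnergy ((Tnd n 3 a)ᶜ) =
        2 * Real.sqrt (4 * (n : ℝ) + 1 +
          8 * Real.sqrt (((a : ℝ) + 1) * ((n : ℝ) - 3 - (a : ℝ))))) ∧
    StrictMonoOn (fun a : ℕ => eccEnergy ((Tnd n 3 a)ᶜ)) (Set.Iic ((n - 4) / 2)) := by
  refine ⟨fun a ha => x_energy hn a ha, ?_⟩
  intro a ha b hb hab
  simp only [Set.mem_Iic] at ha hb
  simp only
  rw [x_energy hn a ha, x_energy hn b hb]
  have h2 : a + b + 5 ≤ n := by omega
  have h2' : (a : ℝ) + b + 5 ≤ n := by exact_mod_cast h2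
  have h3 : (a : ℝ) < b := by exact_mod_cast hab
  have h4 : (0 : ℝ) ≤ a := by positivity
  have h5 : Real.sqrt (((a : ℝ) + 1) * ((n : ℝ) - 3 - (a : ℝ))) <
      Real.sqrt (((b : ℝ) + 1) * ((n : ℝ) - 3 - (b : ℝ))) := by
    apply Real.sqrt_lt_sqrt
    · exact mul_nonneg (by linarith) (by linarith)
    · nlinarith [mul_pos (sub_pos.2 h3) (show (0 : ℝ) < n - 4 - a - b by linarith)]
  have h6 := Real.sqrt_lt_sqrt (by positivity) (show 4 * (n : ℝ) + 1 +
          8 * Real.sqrt (((a : ℝ) + 1) * ((n : ℝ) - 3 - (a : ℝ))) < 4 * (n : ℝ) + 1 +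
          8 * Real.sqrt (((b : ℝ) + 1) * ((n : ℝ) - 3 - (b : ℝ))) by linarith)
  linarith
end
end

section
/- Let T be a tree on n vertices with diameter 3. Then E_𝓔(T^c) ≤ 2·sqrt(8n−7) if n is even, and E_𝓔(T^c) ≤ 2·sqrt(4n+1+4·sqrt(n^2−4n+3)) if n is odd; in either case equality holds if and only if T is isomorphic to T_{n,3}^{⌊(n−4)/2⌋,⌈(n−4)/2⌉}. -/
noncomputable section

open SimpleGraph

/-- Weighted pattern of the double broom: types 0,1 are the centres, 2,3 their leaves. -/
def KK : Fin 4 → Fin 4 → ℕ := ![![0,3,2,0],![3,0,0,2],![2,0,0,0],![0,2,0,0]]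

/-- `t` is a type function exhibiting `T` as a double broom with `p`, `q` leaves. -/
structure Typ {n : ℕ} (T : SimpleGraph (Fin n)) (t : Fin n → Fin 4) (p q : ℕ) : Prop where
  adj : ∀ x y, T.Adj x y ↔ KK (t x) (t y) ≠ 0
  c0 : (Finset.univ.filter fun x => t x = 0).card = 1
  c1 : (Finset.univ.filter fun x => t x = 1).card = 1
  c2 : (Finset.univ.filter fun x => t x = 2).card = p
  c3 : (Finset.univ.filter fun x => t x = 3).card = q
  hp : 0 < p
  hq : 0 < q

namespace Typ

variable {n : ℕ} {T : SimpleGraph (Fin n)} {t : Fin n → Fin 4} {p q : ℕ}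

lemma sum_eq (h : Typ T t p q) : n = p + q + 2 := by
  have := Finset.card_eq_sum_card_fiberwise (f := t) (s := Finset.univ) (t := Finset.univ)
    (fun _ _ => by simp)
  rw [Fin.sum_univ_four, h.c0, h.c1, h.c2, h.c3] at this
  simp at this
  omega

lemma ex (h : Typ T t p q) (i : Fin 4) : ∃ x, t x = i := by
  have h0 := h.c0
  have h1 := h.c1
  have h2 := h.c2
  have h3 := h.c3
  have hp := h.hp
  have hq := h.hq
  have : 0 < (Finset.univ.filter fun x => t x = i).card := by
    fin_cases i <;> simp_all
  obtain ⟨x, hx⟩ := Finset.card_pos.mp this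
  exact ⟨x, by simpa using hx⟩

lemma uniq0 (h : Typ T t p q) {x y : Fin n} (hx : t x = 0) (hy : t y = 0) : x = y :=
  Finset.card_le_one.mp h.c0.le x (by simpa) y (by simpa)

lemma uniq1 (h : Typ T t p q) {x y : Fin n} (hx : t x = 1) (hy : t y = 1) : x = y :=
  Finset.card_le_one.mp h.c1.le x (by simpa) y (by simpa)

lemma cadj (h : Typ T t p q) {x y : Fin n} : Tᶜ.Adj x y ↔ x ≠ y ∧ KK (t x) (t y) = 0 := by
  rw [compl_adj, h.adj]; simp

lemma dist2 (h : Typ T t p q) {x y : Fin n} (hk : KK (t x) (t y) = 2) : Tᶜ.dist x y = 2 := by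
  have hxy : x ≠ y := by
    rintro rfl
    revert hk; generalize t x = i; revert i; decide
  obtain ⟨k, hk1, hk2, hk3, hk4⟩ : ∃ k, KK (t x) k = 0 ∧ KK k (t y) = 0 ∧ k ≠ t x ∧ k ≠ t y := by
    revert hk; generalize t x = i; generalize t y = j; revert i j; decide
  obtain ⟨z, hz⟩ := h.ex k
  have a1 : Tᶜ.Adj x z := h.cadj.2 ⟨by rintro rfl; exact hk3 hz.symm, by rw [hz]; exact hk1⟩
  have a2 : Tᶜ.Adj z y := h.cadj.2 ⟨by rintro rfl; exact hk4 hz.symm, by rw [hz]; exact hk2⟩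
  have le : Tᶜ.dist x y ≤ 2 := dist_le (Walk.cons a1 (Walk.cons a2 Walk.nil))
  have hr : Tᶜ.Reachable x y := a1.reachable.trans a2.reachable
  have := hr.one_lt_dist_of_ne_of_not_adj hxy (by rw [h.cadj]; simp [hk])
  omega

lemma dist3 (h : Typ T t p q) {x y : Fin n} (hx : t x = 0) (hy : t y = 1) : Tᶜ.dist x y = 3 := by
  have hxy : x ≠ y := by
    rintro rfl
    simp [hx] at hy
  obtain ⟨z, hz⟩ := h.ex 3
  obtain ⟨w, hw⟩ := h.ex 2
  have a1 : Tᶜ.Adj x z := h.cadj.2 ⟨by rintro rfl; simp [hx] at hz, by rw [hx, hz]; rfl⟩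
  have a2 : Tᶜ.Adj z w := h.cadj.2 ⟨by rintro rfl; simp [hz] at hw, by rw [hw, hz]; rfl⟩
  have a3 : Tᶜ.Adj w y := h.cadj.2 ⟨by rintro rfl; simp [hy] at hw, by rw [hw, hy]; rfl⟩
  have le : Tᶜ.dist x y ≤ 3 := dist_le (Walk.cons a1 (Walk.cons a2 (Walk.cons a3 Walk.nil)))
  have hr : Tᶜ.Reachable x y := a1.reachable.trans (a2.reachable.trans a3.reachable)
  have h1 := hr.one_lt_dist_of_ne_of_not_adj hxy (by rw [h.cadj]; simp [hx, hy, KK])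
  by_contra hne
  have h2 : Tᶜ.dist x y = 2 := by omega
  obtain ⟨W, hW⟩ := hr.exists_walk_length_eq_dist
  rw [h2] at hW
  match W, hW with
  | .cons (v := u) b1 (.cons b2 .nil), _ =>
    rw [h.cadj] at b1 b2
    have e1 : t u ≠ 0 := fun e => b1.1 (h.uniq0 hx e)
    have e2 : t u ≠ 1 := fun e => b2.1 (h.uniq1 e hy)
    have b1 := b1.2
    have b2 := b2.2
    rw [hx] at b1
    rw [hy] at b2
    revert e1 e2 b1 b2
    generalize t u = i
    revert i
    decide

lemma dist_eq (h : Typ T t p q) {x y : Fin n} (hxy : x ≠ y) :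
    Tᶜ.dist x y = max 1 (KK (t x) (t y)) := by
  have hc : KK (t x) (t y) = 0 ∨ KK (t x) (t y) = 2 ∨ (KK (t x) (t y) = 3 ∧
      (t x = 0 ∧ t y = 1 ∨ t x = 1 ∧ t y = 0)) := by
    generalize t x = i; generalize t y = j; revert i j; decide
  rcases hc with hc | hc | ⟨hc, ⟨hx, hy⟩ | ⟨hx, hy⟩⟩
  · rw [hc, dist_eq_one_iff_adj.2 (h.cadj.2 ⟨hxy, hc⟩)]; rfl
  · rw [hc, h.dist2 hc]; rfl
  · rw [hc, h.dist3 hx hy]; rfl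
  · rw [hc, SimpleGraph.dist_comm, h.dist3 hy hx]; rfl

lemma ecc_eq (h : Typ T t p q) (x : Fin n) : ecc Tᶜ x = (![3,3,2,2] : Fin 4 → ℕ) (t x) := by
  apply le_antisymm
  · apply Finset.sup_le
    intro y _
    by_cases hxy : x = y
    · subst hxy; simp
    rw [h.dist_eq hxy]
    generalize t x = i; generalize t y = j; revert i j; decide
  · obtain ⟨k, hk1, hk2⟩ : ∃ k, k ≠ t x ∧ max 1 (KK (t x) k) = (![3,3,2,2] : Fin 4 → ℕ) (t x) := by
      generalize t x = i; revert i; decide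
    obtain ⟨z, hz⟩ := h.ex k
    have hxz : x ≠ z := by rintro rfl; exact hk1 hz.symm
    rw [← hk2, ← hz, ← h.dist_eq hxz]
    exact Finset.le_sup (f := fun u => Tᶜ.dist x u) (Finset.mem_univ z)

lemma mat_eq (h : Typ T t p q) (x y : Fin n) : eccMatrix Tᶜ x y = (KK (t x) (t y) : ℝ) := by
  unfold eccMatrix
  by_cases hxy : x = y
  · subst hxy
    have : KK (t x) (t x) = 0 := by generalize t x = i; revert i; decide
    simp [this]
  · rw [h.ecc_eq, h.ecc_eq, h.dist_eq hxy]
    have : (if max 1 (KK (t x) (t y)) = min ((![3,3,2,2] : Fin 4 → ℕ) (t x))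
      ((![3,3,2,2] : Fin 4 → ℕ) (t y)) then max 1 (KK (t x) (t y)) else 0) = KK (t x) (t y) := by
      generalize t x = i; generalize t y = j; revert i j; decide
    rw [← Nat.cast_inj (R := ℝ)] at this
    rw [← this]
    simp [hxy]

open Polynomial in
lemma charpoly_eq (h : Typ T t p q) : (eccMatrix Tᶜ).charpoly =
    X ^ (n - 4) * (X ^ 4 - C (9 + 4 * (p:ℝ) + 4 * q) * X ^ 2 + C (16 * (p:ℝ) * q)) := by
  let U : Matrix (Fin n) (Fin 4) ℝ := Matrix.of fun x i => if t x = i then 1 else 0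
  let K : Matrix (Fin 4) (Fin 4) ℝ := Matrix.of fun i j => (KK i j : ℝ)
  have hM : eccMatrix Tᶜ = U * (K * U.transpose) := by
    ext x y
    rw [h.mat_eq]
    simp [U, K, Matrix.mul_apply, Matrix.transpose_apply]
  have hU : U.transpose * U = Matrix.diagonal (![1, 1, (p:ℝ), q] : Fin 4 → ℝ) := by
    ext i j
    have h0 := h.c0
    have h1 := h.c1
    have h2 := h.c2
    have h3 := h.c3
    rw [Matrix.mul_apply]
    simp only [U, Matrix.transpose_apply, Matrix.of_apply]
    by_cases hij : i = j
    · subst hij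
      have : (∑ x, (if t x = i then (1:ℝ) else 0) * (if t x = i then 1 else 0)) =
        ((Finset.univ.filter fun x => t x = i).card : ℝ) := by
        rw [Finset.card_filter]; push_cast
        exact Finset.sum_congr rfl fun x _ => by split_ifs <;> simp
      rw [this, Matrix.diagonal_apply_eq]
      fin_cases i <;> simp_all
    · rw [Matrix.diagonal_apply_ne _ hij]
      apply Finset.sum_eq_zero
      intro x _
      by_cases hx : t x = i
      · simp [hx, hij]
      · simp [hx]
  have hn := h.sum_eq
  have hp := h.hp
  have hq := h.hq
  rw [hM, Matrix.charpoly_mul_comm_of_le _ _ (by simp; omega), Matrix.mul_assoc, hU]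
  simp only [Fintype.card_fin]
  congr 1
  have hKd : K * Matrix.diagonal (![1, 1, (p:ℝ), q] : Fin 4 → ℝ) =
      !![0,3,2*(p:ℝ),0;3,0,0,2*(q:ℝ);2,0,0,0;0,2,0,0] := by
    ext i j
    rw [Matrix.mul_diagonal]
    fin_cases i <;> fin_cases j <;> simp [K, KK]
  rw [hKd, Matrix.charpoly, Matrix.charmatrix]
  simp [Matrix.det_succ_row_zero, Fin.sum_univ_succ, Fin.succAbove]
  have e2 : (C 2 : ℝ[X]) = 2 := rfl
  have e3 : (C 3 : ℝ[X]) = 3 := rfl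
  have e4 : (C 4 : ℝ[X]) = 4 := rfl
  have e9 : (C 9 : ℝ[X]) = 9 := rfl
  have e16 : (C 16 : ℝ[X]) = 16 := rfl
  simp only [e2, e3, e4, e9, e16]
  ring

open Polynomial in
lemma energy_eq (h : Typ T t p q) :
    eccEnergy Tᶜ = 2 * Real.sqrt (4 * (n:ℝ) + 1 + 8 * Real.sqrt (p * q : ℕ)) := by
  set m := Real.sqrt (p * q : ℕ) with hm
  have hm0 : 0 ≤ m := Real.sqrt_nonneg _
  have hmm : m * m = p * q := by
    rw [hm, Real.mul_self_sqrt (by positivity)]; push_cast; ring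
  set S := Real.sqrt (4 * (n:ℝ) + 1 + 8 * m) with hS
  have hSS : S * S = 4 * (n:ℝ) + 1 + 8 * m := Real.mul_self_sqrt (by positivity)
  have hS0 : 0 ≤ S := Real.sqrt_nonneg _
  have hn : (n:ℝ) = p + q + 2 := by exact_mod_cast h.sum_eq
  have hle : 8 * m ≤ 4 * (n:ℝ) + 1 := by
    have : 2 * m ≤ p + q := by
      apply abs_le_of_sq_le_sq' _ (by positivity) |>.2
      nlinarith [sq_nonneg ((p:ℝ) - q)]
    rw [hn]; linarith
  set R := Real.sqrt (4 * (n:ℝ) + 1 - 8 * m) with hR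
  have hRR : R * R = 4 * (n:ℝ) + 1 - 8 * m := Real.mul_self_sqrt (by linarith)
  have hR0 : 0 ≤ R := Real.sqrt_nonneg _
  have hRS : R ≤ S := Real.sqrt_le_sqrt (by linarith)
  set α := (S + R) / 2 with hα
  set β := (S - R) / 2 with hβ
  have hα0 : 0 ≤ α := by positivity
  have hβ0 : 0 ≤ β := by rw [hβ]; linarith
  have e1 : α ^ 2 + β ^ 2 = 9 + 4 * (p:ℝ) + 4 * q := by
    rw [hα, hβ]; nlinarith
  have e2 : α ^ 2 * β ^ 2 = 16 * (p:ℝ) * q := by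
    have : α * β = 4 * m := by rw [hα, hβ]; nlinarith
    rw [← mul_pow, this]; nlinarith
  have hc : (eccMatrix Tᶜ).charpoly =
      X ^ (n - 4) * ((X - C α) * (X - C (-α)) * ((X - C β) * (X - C (-β)))) := by
    rw [h.charpoly_eq, ← e1, ← e2]
    congr 1
    simp only [map_add, map_mul, map_pow, map_neg]
    ring
  have hr : eccEigs Tᶜ = (n - 4) • {0} + ({α} + {-α} + ({β} + {-β})) := by
    unfold eccEigs
    rw [hc]
    have n1 : ((X - C α) * (X - C (-α)) : ℝ[X]) ≠ 0 := mul_ne_zero (X_sub_C_ne_zero _) (X_sub_C_ne_zero _)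
    have n2 : ((X - C β) * (X - C (-β)) : ℝ[X]) ≠ 0 := mul_ne_zero (X_sub_C_ne_zero _) (X_sub_C_ne_zero _)
    have n3 := mul_ne_zero n1 n2
    rw [roots_mul (mul_ne_zero (pow_ne_zero _ X_ne_zero) n3), roots_mul n3, roots_mul n1,
      roots_mul n2, roots_X_pow]
    simp only [roots_X_sub_C]
  unfold eccEnergy
  rw [hr]
  simp only [Multiset.map_add, Multiset.sum_add, Multiset.map_nsmul, Multiset.sum_nsmul,
    Multiset.map_singleton, Multiset.sum_singleton, abs_neg, abs_zero, abs_of_nonneg hα0,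
    abs_of_nonneg hβ0]
  rw [hα, hβ]
  simp
  ring

lemma swap (h : Typ T t p q) : Typ T (fun x => (![1,0,3,2] : Fin 4 → Fin 4) (t x)) q p where
  adj x y := by
    rw [h.adj]
    generalize t x = i; generalize t y = j; revert i j; decide
  c0 := by
    refine Eq.trans ?_ h.c1; congr 2; ext x; generalize t x = i; revert i; decide
  c1 := by
    refine Eq.trans ?_ h.c0; congr 2; ext x; generalize t x = i; revert i; decide
  c2 := by
    refine Eq.trans ?_ h.c3; congr 2; ext x; generalize t x = i; revert i; decide
  c3 := by
    refine Eq.trans ?_ h.c2; congr 2; ext x; generalize t x = i; revert i; decide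
  hp := h.hq
  hq := h.hp

lemma iso {T' : SimpleGraph (Fin n)} {t' : Fin n → Fin 4} (h : Typ T t p q)
    (h' : Typ T' t' p q) : Nonempty (T ≃g T') := by
  have hf : ∀ i, Nonempty ({x // t x = i} ≃ {x // t' x = i}) := by
    intro i
    refine Fintype.card_eq.mp ?_
    rw [Fintype.card_subtype, Fintype.card_subtype]
    have h0 := h.c0
    have h1 := h.c1
    have h2 := h.c2
    have h3 := h.c3
    have h0' := h'.c0
    have h1' := h'.c1
    have h2' := h'.c2
    have h3' := h'.c3
    fin_cases i <;> simp_all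
  let e := Equiv.ofFiberEquiv (f := t) (g := t') fun i => (hf i).some
  have he : ∀ x, t' (e x) = t x := fun x => Equiv.ofFiberEquiv_map _ x
  exact ⟨⟨e, by intro a b; rw [h'.adj, h.adj, he, he]⟩⟩

lemma pull {T' : SimpleGraph (Fin n)} (h : Typ T t p q) (e : T' ≃g T) : Typ T' (t ∘ e) p q where
  adj x y := by rw [← e.map_adj_iff, h.adj]; rfl
  c0 := by rw [← h.c0]; exact Finset.card_equiv e.toEquiv (by intro i; simp)
  c1 := by rw [← h.c1]; exact Finset.card_equiv e.toEquiv (by intro i; simp)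
  c2 := by rw [← h.c2]; exact Finset.card_equiv e.toEquiv (by intro i; simp)
  c3 := by rw [← h.c3]; exact Finset.card_equiv e.toEquiv (by intro i; simp)
  hp := h.hp
  hq := h.hq

end Typ

/-- Type function of `Tnd n 3 a`. -/
def tt (a k : ℕ) : Fin 4 :=
  if k = 0 then 2 else if k = 1 then 0 else if k = 2 then 1 else if k = 3 then 3
  else if k ≤ 3 + a then 2 else 3

lemma tt_adj (a x y : ℕ) : (x ≠ y ∧ (((x + 1 = y ∧ y ≤ 3) ∨ (x = 1 ∧ 3 < y ∧ y ≤ 3 + a) ∨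
    (x = 3 - 1 ∧ 3 + a < y)) ∨ ((y + 1 = x ∧ x ≤ 3) ∨ (y = 1 ∧ 3 < x ∧ x ≤ 3 + a) ∨
    (y = 3 - 1 ∧ 3 + a < x)))) ↔ KK (tt a x) (tt a y) ≠ 0 := by
  unfold tt
  split_ifs <;> simp [KK] <;> omega

lemma card_fin_eq {n : ℕ} (P : ℕ → Prop) [DecidablePred P] :
    (Finset.univ.filter fun x : Fin n => P x).card = ((Finset.range n).filter P).card := by
  rw [← Finset.card_map Fin.valEmbedding]
  congr 1
  ext k
  simp only [Finset.mem_map, Finset.mem_filter, Finset.mem_univ, true_and, Finset.mem_range,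
    Fin.valEmbedding_apply]
  constructor
  · rintro ⟨x, hx, rfl⟩
    exact ⟨x.2, hx⟩
  · rintro ⟨hk, hP⟩
    exact ⟨⟨k, hk⟩, hP, rfl⟩

lemma typ_Tnd {n a : ℕ} (hn : a + 4 ≤ n) : Typ (Tnd n 3 a) (fun x => tt a x.val) (a + 1) (n - 3 - a) where
  adj x y := by
    rw [← tt_adj]; simp only [Tnd, fromRel_adj, ne_eq, Fin.ext_iff]
  c0 := by
    rw [card_fin_eq (fun k => tt a k = 0)]
    have : (Finset.range n).filter (fun k => tt a k = 0) = {1} := by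
      ext k
      simp only [Finset.mem_filter, Finset.mem_range, Finset.mem_singleton]
      unfold tt
      split_ifs <;> simp <;> omega
    rw [this]; rfl
  c1 := by
    rw [card_fin_eq (fun k => tt a k = 1)]
    have : (Finset.range n).filter (fun k => tt a k = 1) = {2} := by
      ext k
      simp only [Finset.mem_filter, Finset.mem_range, Finset.mem_singleton]
      unfold tt
      split_ifs <;> simp <;> omega
    rw [this]; rfl
  c2 := by
    rw [card_fin_eq (fun k => tt a k = 2)]
    have : (Finset.range n).filter (fun k => tt a k = 2) = insert 0 (Finset.Ico 4 (4 + a)) := by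
      ext k
      simp only [Finset.mem_filter, Finset.mem_range, Finset.mem_insert, Finset.mem_Ico]
      unfold tt
      split_ifs <;> simp <;> omega
    rw [this, Finset.card_insert_of_notMem (by simp)]
    simp
  c3 := by
    rw [card_fin_eq (fun k => tt a k = 3)]
    have : (Finset.range n).filter (fun k => tt a k = 3) = insert 3 (Finset.Ico (4 + a) n) := by
      ext k
      simp only [Finset.mem_filter, Finset.mem_range, Finset.mem_insert, Finset.mem_Ico]
      unfold tt
      split_ifs <;> simp <;> omega
    rw [this, Finset.card_insert_of_notMem (by simp; omega)]
    simp; omega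
  hp := by omega
  hq := by omega

lemma parent_unique {n : ℕ} {T : SimpleGraph (Fin n)} (hT : T.IsTree) {x y z w : Fin n}
    (hy : T.Adj y z) (hw : T.Adj w z) (h1 : T.dist x z = T.dist x y + 1)
    (h2 : T.dist x z = T.dist x w + 1) : y = w := by
  obtain ⟨p, hp⟩ := hT.connected.exists_walk_length_eq_dist x y
  obtain ⟨q, hq⟩ := hT.connected.exists_walk_length_eq_dist x w
  have hp' : (p.concat hy).IsPath :=
    Walk.isPath_of_length_eq_dist _ (by rw [Walk.length_concat]; omega)
  have hq' : (q.concat hw).IsPath :=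
    Walk.isPath_of_length_eq_dist _ (by rw [Walk.length_concat]; omega)
  have := (hT.existsUnique_path x z).unique hp' hq'
  have h3 := congrArg Walk.penultimate this
  simpa using h3

lemma dist_next {n : ℕ} {T : SimpleGraph (Fin n)} (hT : T.IsTree) (x : Fin n) {y z w : Fin n}
    (hy : T.Adj y z) (hw : T.Adj z w) (hne : y ≠ w) (h1 : T.dist x z = T.dist x y + 1) :
    T.dist x w = T.dist x z + 1 := by
  rcases hT.dist_eq_dist_add_one_of_adj x hw with h | h
  · exact absurd (parent_unique hT hy hw.symm h1 h) hne
  · exact h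

lemma exists_typ {n : ℕ} {T : SimpleGraph (Fin n)} (hT : T.IsTree) (hd : gdiam T = 3) :
    ∃ t p q, Typ T t p q := by
  have hle : ∀ x y, T.dist x y ≤ 3 := fun x y => by
    rw [← hd]
    exact Finset.le_sup (f := fun p : Fin n × Fin n => T.dist p.1 p.2) (Finset.mem_univ (x, y))
  obtain ⟨a, b, hab⟩ : ∃ a b, T.dist a b = 3 := by
    by_contra hcon
    push Not at hcon
    have : gdiam T ≤ 2 := Finset.sup_le fun p _ => by
      have := hle p.1 p.2
      have := hcon p.1 p.2
      omega
    omega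
  obtain ⟨W, hW⟩ := hT.connected.exists_walk_length_eq_dist a b
  rw [hab] at hW
  obtain ⟨c, d, hac, hcd, hdb⟩ : ∃ c d, T.Adj a c ∧ T.Adj c d ∧ T.Adj d b := by
    match W, hW with
    | .cons (v := c) b1 (.cons (v := d) b2 (.cons b3 .nil)), _ => exact ⟨c, d, b1, b2, b3⟩
  have had : a ≠ d := by
    rintro rfl
    rw [dist_eq_one_iff_adj.2 hdb] at hab
    omega
  have hcb : c ≠ b := by
    rintro rfl
    rw [dist_eq_one_iff_adj.2 hac] at hab
    omega
  have hcov : ∀ x, (x = c ∨ T.Adj x c) ∨ (x = d ∨ T.Adj x d) := by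
    intro x
    have key : ∀ z, T.dist x z ≤ 1 → x = z ∨ T.Adj x z := by
      intro z hz
      rcases Nat.le_one_iff_eq_zero_or_eq_one.mp hz with h | h
      · left; exact hT.connected.dist_eq_zero_iff.mp h
      · right; exact dist_eq_one_iff_adj.mp h
    rcases hT.dist_eq_dist_add_one_of_adj x hcd with h | h
    · right
      apply key
      have := dist_next hT x hcd.symm hac.symm had.symm h
      have := hle x a
      omega
    · left
      apply key
      have := dist_next hT x hcd hdb hcb h
      have := hle x b
      omega
  have hcd' := hcd.ne
  have notri : ∀ x y z, T.Adj x y → T.Adj z x → T.Adj z y → False := by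
    intro x y z h1 h2 h3
    have := hT.dist_ne_of_adj z h1
    rw [dist_eq_one_iff_adj.2 h2, dist_eq_one_iff_adj.2 h3] at this
    exact this rfl
  have nosq : ∀ x y, x ≠ d → y ≠ c → T.Adj x c → T.Adj y d → T.Adj x y → False := by
    intro x y hx hy h1 h2 h3
    have h4 : T.dist c d = 1 := dist_eq_one_iff_adj.2 hcd
    have h5 : T.dist c c = 0 := by simp
    have h6 := dist_next hT c hcd h2.symm hy.symm (by omega)
    have h7 := dist_next hT c h2.symm h3.symm hx.symm h6
    have h8 := dist_eq_one_iff_adj.2 h1.symm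
    omega
  classical
  let t : Fin n → Fin 4 := fun x => if x = c then 0 else if x = d then 1 else
    if T.Adj x c then 2 else 3
  have ht : ∀ x, (t x = 0 ∧ x = c) ∨ (t x = 1 ∧ x = d) ∨ (t x = 2 ∧ x ≠ c ∧ x ≠ d ∧ T.Adj x c ∧ ¬ T.Adj x d)
      ∨ (t x = 3 ∧ x ≠ c ∧ x ≠ d ∧ ¬ T.Adj x c ∧ T.Adj x d) := by
    intro x
    have h1 := hcov x
    have h2 := notri c d x hcd
    by_cases e1 : x = c
    · simp [t, e1]
    by_cases e2 : x = d
    · simp [t, e2, hcd'.symm]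
    by_cases e3 : T.Adj x c
    · simp [t, e1, e2, e3]; tauto
    · simp [t, e1, e2, e3]; tauto
  have t0 : ∀ x, t x = 0 ↔ x = c := by
    intro x; rcases ht x with h | h | h | h <;> rw [h.1] <;> simp [h.2, hcd'.symm]
  have t1 : ∀ x, t x = 1 ↔ x = d := by
    intro x; rcases ht x with h | h | h | h <;> rw [h.1] <;> simp [h.2, hcd']
  refine ⟨t, _, _, ⟨?_, ?_, ?_, rfl, rfl, ?_, ?_⟩⟩
  · intro x y
    rcases ht x with ⟨h, h'⟩ | ⟨h, h'⟩ | ⟨h, h'⟩ | ⟨h, h'⟩ <;>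
    rcases ht y with ⟨g, g'⟩ | ⟨g, g'⟩ | ⟨g, g'⟩ | ⟨g, g'⟩ <;>
    simp [h, g, KK] <;> grind [T.adj_comm, SimpleGraph.irrefl]
  · simp only [t0]; exact Finset.card_eq_one.2 ⟨c, by ext; simp⟩
  · simp only [t1]; exact Finset.card_eq_one.2 ⟨d, by ext; simp⟩
  · apply Finset.card_pos.mpr
    refine ⟨a, ?_⟩
    simp
    have := hac.ne
    rcases ht a with h | h | h | h <;> tauto
  · apply Finset.card_pos.mpr
    refine ⟨b, ?_⟩
    simp
    have := hdb.ne
    have := hdb.symm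
    rcases ht b with h | h | h | h <;> grind

/-- Corollary 5.3: maximum `𝓔`-energy among complements of trees of diameter
`3`. -/
theorem stmt_15 {n : ℕ} (T : SimpleGraph (Fin n)) (hT : T.IsTree) (hd : gdiam T = 3) (B : ℝ)
    (hB : B = if Even n then 2 * Real.sqrt (8 * (n : ℝ) - 7)
      else 2 * Real.sqrt (4 * (n : ℝ) + 1 +
        4 * Real.sqrt ((n : ℝ) ^ 2 - 4 * (n : ℝ) + 3))) :
    eccEnergy Tᶜ ≤ B ∧ (eccEnergy Tᶜ = B ↔ Nonempty (T ≃g Tnd n 3 ((n - 4) / 2))) := by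
  
  have hB' : ∀ p q : ℕ, n = p + q + 2 → p ≤ q → q ≤ p + 1 →
      B = 2 * Real.sqrt (4 * (n:ℝ) + 1 + 8 * Real.sqrt (p * q : ℕ)) := by
    intro p q hn h1 h2
    rw [hB]
    have hnr : (n:ℝ) = p + q + 2 := by exact_mod_cast hn
    rcases (show q = p ∨ q = p + 1 by omega) with rfl | rfl
    · rw [if_pos ⟨q + 1, by omega⟩]
      push_cast
      rw [Real.sqrt_mul_self (by positivity), hnr]
      congr 2; ring
    · rw [if_neg (by rw [Nat.not_even_iff_odd]; exact ⟨p + 1, by omega⟩)]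
      have : (n:ℝ) ^ 2 - 4 * n + 3 = 2 ^ 2 * ((p * (p + 1) : ℕ) : ℝ) := by
        rw [hnr]; push_cast; ring
      rw [this, Real.sqrt_mul (by positivity), Real.sqrt_sq (by norm_num)]
      congr 2; ring
  obtain ⟨t, p, q, h, hpq⟩ : ∃ t p q, Typ T t p q ∧ p ≤ q := by
    obtain ⟨t, p, q, h⟩ := exists_typ hT hd
    rcases le_total p q with hpq | hpq
    · exact ⟨t, p, q, h, hpq⟩
    · exact ⟨_, _, _, h.swap, hpq⟩
  have hn := h.sum_eq
  have hp := h.hp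
  have hq := h.hq
  have h0 : Typ (Tnd n 3 ((n - 4) / 2)) _ _ _ := typ_Tnd (by omega)
  have hn0 := h0.sum_eq
  obtain ⟨p0, hp0⟩ : ∃ p0, p0 = (n - 4) / 2 + 1 := ⟨_, rfl⟩
  obtain ⟨q0, hq0⟩ : ∃ q0, q0 = n - 3 - (n - 4) / 2 := ⟨_, rfl⟩
  rw [← hp0, ← hq0] at h0 hn0
  have hpq0 : p0 ≤ q0 := by omega
  have hpq1 : q0 ≤ p0 + 1 := by omega
  have hBe := hB' p0 q0 hn0 hpq0 hpq1
  have hple : p ≤ p0 := by omega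
  have hlt : p ≠ p0 → p * q < p0 * q0 := by
    intro hne
    obtain ⟨k, rfl⟩ : ∃ k, p0 = p + k + 1 := ⟨p0 - p - 1, by omega⟩
    obtain rfl : q = q0 + k + 1 := by omega
    nlinarith
  have hlt' : p ≠ p0 → eccEnergy Tᶜ < B := by
    intro hne
    rw [hBe, h.energy_eq]
    have : Real.sqrt (p * q : ℕ) < Real.sqrt (p0 * q0 : ℕ) :=
      Real.sqrt_lt_sqrt (by positivity) (by exact_mod_cast hlt hne)
    have := Real.sqrt_lt_sqrt (x := 4 * (n:ℝ) + 1 + 8 * Real.sqrt (p * q : ℕ))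
      (y := 4 * (n:ℝ) + 1 + 8 * Real.sqrt (p0 * q0 : ℕ)) (by positivity) (by linarith)
    linarith
  have heq : p = p0 → eccEnergy Tᶜ = B := by
    intro he
    have hqe : q = q0 := by omega
    rw [hBe, h.energy_eq, he, hqe]
  refine ⟨?_, ?_, ?_⟩
  · by_cases he : p = p0
    · exact (heq he).le
    · exact (hlt' he).le
  · intro hE
    have he : p = p0 := by
      by_contra he
      exact absurd hE (hlt' he).ne
    have hqe : q = q0 := by omega
    subst he hqe
    exact h.iso h0
  · rintro ⟨e⟩
    rw [hBe, (h0.pull e).energy_eq]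
end
end
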